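/- arXiv:2308.10246 — 3 statements merged into one kernel-verified Lean document; each statement's English description precedes it below -/
import Mathlib

section
/- Let p be a prime, f ≥ 1, q = p^f, and a, b, c, d ∈ 𝔽_q. In 𝔽_q[X_0,Y_0,…,X_{f−1},Y_{f−1}], set ∇_j = a^{p^j}∂/∂X_j + b^{p^j}∂/∂Y_j for 0 ≤ j ≤ f−1, and let θ_0 = X_0·Y_{f−1}^p − Y_0·X_{f−1}^p, θ_k = X_k·Y_{k−1}^p − Y_k·X_{k−1}^p (1 ≤ k ≤ f−1). Let 0 ≤ l_j, k_j ≤ p−1 for each j, and denote by ev the evaluation X_j ↦ c^{p^j}, Y_j ↦ d^{p^j}. Then ev( (∏_{j=0}^{f−1} ∇_j^{l_j})( ∏_{j=0}^{f−1} θ_j^{k_j} ) ) equals l_0!·⋯·l_{f−1}!·∏_{j=0}^{f−1} ( ev(∇_j(θ_j)) )^{l_j} if (l_0,…,l_{f−1}) = (k_0,…,k_{f−1}), and equals 0 otherwise. -/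
open MvPolynomial

noncomputable section

/-- The twisted Dickson polynomial `θ_k = X_k·Y_{k−1}^p − Y_k·X_{k−1}^p`
(indices mod `f`, so `θ_0 = X_0·Y_{f−1}^p − Y_0·X_{f−1}^p`), in
`𝔽_q[X_0,Y_0,…,X_{f−1},Y_{f−1}]` with `X_j = X (j,0)`, `Y_j = X (j,1)`. -/
def thetaTw (p f : ℕ) [Fact p.Prime] [NeZero f] (k : Fin f) :
    MvPolynomial (Fin f × Fin 2) (GaloisField p f) :=
  X (k, 0) * X (k - 1, 1) ^ p - X (k, 1) * X (k - 1, 0) ^ p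

/-- The differential operator `∇_j = a^{p^j} ∂/∂X_j + b^{p^j} ∂/∂Y_j`. -/
def nablaTw (p f : ℕ) [Fact p.Prime] (a b : GaloisField p f) (j : Fin f) :
    Module.End (GaloisField p f) (MvPolynomial (Fin f × Fin 2) (GaloisField p f)) :=
  (a ^ p ^ (j : ℕ)) • (pderiv ((j, 0) : Fin f × Fin 2)).toLinearMap +
    (b ^ p ^ (j : ℕ)) • (pderiv ((j, 1) : Fin f × Fin 2)).toLinearMap

/-- Evaluation `X_j ↦ c^{p^j}`, `Y_j ↦ d^{p^j}`. -/
def evTw (p f : ℕ) [Fact p.Prime] (c d : GaloisField p f)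
    (P : MvPolynomial (Fin f × Fin 2) (GaloisField p f)) : GaloisField p f :=
  eval (fun v : Fin f × Fin 2 =>
    if v.2 = 0 then c ^ p ^ (v.1 : ℕ) else d ^ p ^ (v.1 : ℕ)) P

end

namespace Derivation

variable {R A : Type*} [CommRing R] [CommRing A] [Algebra R A]

theorem map_mul_eq_zero (D : Derivation R A A) {x y : A} (hx : D x = 0) (hy : D y = 0) :
    D (x * y) = 0 := by
  simp [hx, hy]

theorem map_pow_eq_zero (D : Derivation R A A) {x : A} (hx : D x = 0) (n : ℕ) :
    D (x ^ n) = 0 := by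
  simp [Derivation.leibniz_pow, hx]

theorem map_prod_eq_zero {ι : Type*} (D : Derivation R A A) (s : Finset ι) (g : ι → A)
    (h : ∀ i ∈ s, D (g i) = 0) : D (∏ i ∈ s, g i) = 0 :=
  Finset.prod_induction g (fun x => D x = 0) (fun _ _ => D.map_mul_eq_zero)
    D.map_one_eq_zero h

/-- Iterates of a derivation on `t ^ k * C`, where `C` and the derivative of `t` are constants. -/
theorem toLinearMap_pow_apply_pow_mul (D : Derivation R A A) {t C : A} (ht : D (D t) = 0)
    (hC : D C = 0) (k n : ℕ) :
    ((D : A →ₗ[R] A) ^ n) (t ^ k * C) =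
      (k.descFactorial n : A) * D t ^ n * t ^ (k - n) * C := by
  induction n with
  | zero => simp
  | succ n ih =>
    have hconst : D ((k.descFactorial n : A) * D t ^ n) = 0 :=
      D.map_mul_eq_zero (D.map_natCast _) (D.map_pow_eq_zero ht n)
    rw [pow_succ', Module.End.mul_apply, ih, Derivation.coeFn_coe, D.leibniz, D.leibniz, hC,
      hconst, Derivation.leibniz_pow, Nat.descFactorial_succ, Nat.sub_sub]
    simp only [smul_eq_mul, nsmul_eq_mul, mul_zero, add_zero, zero_add]
    push_cast
    ring

/-- Mixed iterates of derivations on a product of powers, when each derivation only sees its own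
factor and the first derivatives are constants. -/
theorem list_prod_pow_apply_prod_pow {ι : Type*} [Fintype ι] [DecidableEq ι]
    (D : ι → Derivation R A A) (t : ι → A) (hne : ∀ i j, i ≠ j → D i (t j) = 0)
    (hD : ∀ i j, D i (D j (t j)) = 0) (l k : ι → ℕ) (L : List ι) (hL : L.Nodup) :
    (L.map fun j => (D j : A →ₗ[R] A) ^ l j).prod (∏ j, t j ^ k j) =
      ∏ j, if j ∈ L then ((k j).descFactorial (l j) : A) * D j (t j) ^ l j * t j ^ (k j - l j)
        else t j ^ k j := by
  induction L with
  | nil => simp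
  | cons i L ih =>
    obtain ⟨hi, hL⟩ := List.nodup_cons.mp hL
    rw [List.map_cons, List.prod_cons, Module.End.mul_apply, ih hL,
      ← Finset.mul_prod_erase _ _ (Finset.mem_univ i), if_neg hi,
      toLinearMap_pow_apply_pow_mul _ (hD i i),
      ← Finset.mul_prod_erase Finset.univ (fun j => ite (j ∈ i :: L) _ _) (Finset.mem_univ i),
      if_pos List.mem_cons_self]
    · congr 1
      refine Finset.prod_congr rfl fun j hj => ?_
      simp [Finset.ne_of_mem_erase hj]
    · refine map_prod_eq_zero _ _ _ fun j hj => ?_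
      have hij := hne i j (Finset.ne_of_mem_erase hj).symm
      split_ifs
      · exact map_mul_eq_zero _ (map_mul_eq_zero _ (map_natCast _ _)
          (map_pow_eq_zero _ (hD i j) _)) (map_pow_eq_zero _ hij _)
      · exact map_pow_eq_zero _ hij _

end Derivation

/-- The operator `∇_j` as a derivation. -/
noncomputable def nablaTwDerivation (p f : ℕ) [Fact p.Prime] (a b : GaloisField p f) (j : Fin f) :
    Derivation (GaloisField p f) (MvPolynomial (Fin f × Fin 2) (GaloisField p f))
      (MvPolynomial (Fin f × Fin 2) (GaloisField p f)) :=
  (a ^ p ^ (j : ℕ)) • pderiv ((j, 0) : Fin f × Fin 2) +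
    (b ^ p ^ (j : ℕ)) • pderiv ((j, 1) : Fin f × Fin 2)

section

variable (p f : ℕ) [Fact p.Prime] (a b c d : GaloisField p f)

theorem nablaTw_eq_coe_nablaTwDerivation (j : Fin f) :
    nablaTw p f a b j = (nablaTwDerivation p f a b j : Module.End (GaloisField p f)
      (MvPolynomial (Fin f × Fin 2) (GaloisField p f))) := rfl

theorem nablaTwDerivation_pow_char (j : Fin f)
    (P : MvPolynomial (Fin f × Fin 2) (GaloisField p f)) :
    nablaTwDerivation p f a b j (P ^ p) = 0 := by
  simp [Derivation.leibniz_pow]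

theorem nablaTwDerivation_thetaTw_of_ne [NeZero f] {i j : Fin f} (h : i ≠ j) :
    nablaTwDerivation p f a b i (thetaTw p f j) = 0 := by
  have hX (e : Fin 2) : nablaTwDerivation p f a b i (X (j, e)) = 0 := by
    simp [nablaTwDerivation, pderiv_X, h.symm]
  simp [thetaTw, hX]

theorem nablaTwDerivation_thetaTw_self [NeZero f] (j : Fin f) :
    nablaTwDerivation p f a b j (thetaTw p f j) =
      (a ^ p ^ (j : ℕ)) • X (j - 1, 1) ^ p - (b ^ p ^ (j : ℕ)) • X (j - 1, 0) ^ p := by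
  have hX : nablaTwDerivation p f a b j (X (j, 0)) = C (a ^ p ^ (j : ℕ)) := by
    simp [nablaTwDerivation, pderiv_X, smul_eq_C_mul]
  have hY : nablaTwDerivation p f a b j (X (j, 1)) = C (b ^ p ^ (j : ℕ)) := by
    simp [nablaTwDerivation, pderiv_X, smul_eq_C_mul]
  simp [thetaTw, hX, hY, smul_eq_C_mul, mul_comm]

theorem nablaTwDerivation_nablaTwDerivation_thetaTw [NeZero f] (i j : Fin f) :
    nablaTwDerivation p f a b i (nablaTwDerivation p f a b j (thetaTw p f j)) = 0 := by
  rw [nablaTwDerivation_thetaTw_self, map_sub, Derivation.map_smul, Derivation.map_smul,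
    nablaTwDerivation_pow_char, nablaTwDerivation_pow_char]
  simp

variable {p f} in
theorem GaloisField.pow_pow_sub_one_pow [NeZero f] (x : GaloisField p f) (j : Fin f) :
    (x ^ p ^ ((j - 1 : Fin f) : ℕ)) ^ p = x ^ p ^ (j : ℕ) := by
  rw [← pow_mul, ← pow_succ]
  by_cases hj : j = 0
  · subst hj
    have hf := NeZero.ne f
    have hval : ((0 - 1 : Fin f) : ℕ) + 1 = f := by
      obtain ⟨m, rfl⟩ := Nat.exists_eq_succ_of_ne_zero hf
      rw [zero_sub, Fin.coe_neg_one]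
    have hcard : x ^ p ^ f = x := by
      have := Fintype.ofFinite (GaloisField p f)
      rw [← GaloisField.card p f hf, Nat.card_eq_fintype_card, FiniteField.pow_card]
    rw [hval, hcard, Fin.val_zero, pow_zero, pow_one]
  · rw [Fin.val_sub_one_of_ne_zero hj,
      Nat.sub_add_cancel (Nat.pos_of_ne_zero (Fin.val_ne_zero_iff.mpr hj))]

theorem evTw_thetaTw [NeZero f] (j : Fin f) : evTw p f c d (thetaTw p f j) = 0 := by
  simp [evTw, thetaTw, GaloisField.pow_pow_sub_one_pow, mul_comm]

end


/-- with `0 ≤ l_j, k_j ≤ p−1`,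
`ev((∏_j ∇_j^{l_j})(∏_j θ_j^{k_j}))` equals `l_0!⋯l_{f−1}!·∏_j (ev(∇_j(θ_j)))^{l_j}` if
`(l_0,…,l_{f−1}) = (k_0,…,k_{f−1})`, and `0` otherwise. -/
theorem nablaTw_prod_thetaTw_prod_eval (p f : ℕ) [Fact p.Prime] [NeZero f]
    (a b c d : GaloisField p f) (l k : Fin f → ℕ)
    (hl : ∀ j, l j ≤ p - 1) (hk : ∀ j, k j ≤ p - 1) :
    evTw p f c d
        ((((List.finRange f).map fun j => nablaTw p f a b j ^ l j).prod)
          (∏ j : Fin f, thetaTw p f j ^ k j)) =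
      if l = k then
        (∏ j : Fin f, (Nat.factorial (l j) : GaloisField p f)) *
          ∏ j : Fin f, (evTw p f c d (nablaTw p f a b j (thetaTw p f j))) ^ l j
      else 0 := by
  have key := Derivation.list_prod_pow_apply_prod_pow (nablaTwDerivation p f a b) (thetaTw p f)
    (fun i j => nablaTwDerivation_thetaTw_of_ne p f a b)
    (nablaTwDerivation_nablaTwDerivation_thetaTw p f a b) l k _ (List.nodup_finRange f)
  simp only [← nablaTw_eq_coe_nablaTwDerivation, List.mem_finRange, if_true] at key
  rw [key]
  have hprod : evTw p f c d (∏ j, (((k j).descFactorial (l j) :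
      MvPolynomial (Fin f × Fin 2) (GaloisField p f)) *
        nablaTwDerivation p f a b j (thetaTw p f j) ^ l j * thetaTw p f j ^ (k j - l j))) =
      ∏ j, (((k j).descFactorial (l j) : GaloisField p f) *
        evTw p f c d (nablaTw p f a b j (thetaTw p f j)) ^ l j * 0 ^ (k j - l j)) := by
    have h_theta := evTw_thetaTw p f c d
    simp only [evTw] at h_theta
    simp [evTw, nablaTw_eq_coe_nablaTwDerivation, h_theta]
  rw [hprod]
  split_ifs with h
  · subst h
    simp [Nat.descFactorial_self, Finset.prod_mul_distrib]
  · obtain ⟨j, hj⟩ := Function.ne_iff.mp h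
    refine Finset.prod_eq_zero (Finset.mem_univ j) ?_
    rcases lt_or_gt_of_ne hj with hlt | hgt
    · simp [zero_pow (Nat.sub_ne_zero_of_lt hlt)]
    · simp [Nat.descFactorial_of_lt hgt]
end

section
/- Let p be a prime, 0 ≤ m ≤ p−1, and let r ≥ (m+1)(p+1) be an integer with r ≡ 0 mod p(p−1). Let ψ : V_r → (functions ℙ¹(𝔽_p[ε]) → 𝔽_p[ε]) be the map sending P to the function [c:d] ↦ P(c,d) (well defined since P is homogeneous of degree r and u^r = 1 for every unit u of 𝔽_p[ε]). Then the image of ψ equals the set of functions h : ℙ¹(𝔽_p[ε]) → 𝔽_p[ε] such that h(β) ∈ 𝔽_p for every β ∈ ℙ¹(𝔽_p) ⊆ ℙ¹(𝔽_p[ε]) and h is smooth. -/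
open MvPolynomial

/-- The ring of generalized dual numbers `𝔽_p[ε] = 𝔽_p[x]/(x^{m+1})`. -/
abbrev DualNum (p m : ℕ) : Type :=
  Polynomial (ZMod p) ⧸ Ideal.span {(Polynomial.X : Polynomial (ZMod p)) ^ (m + 1)}

/-- The element `ε`, the image of `x` in `𝔽_p[ε]`. -/
noncomputable def eps (p m : ℕ) : DualNum p m :=
  Ideal.Quotient.mk _ Polynomial.X

/-- Unimodular pairs over `𝔽_p[ε]`: pairs `(c,d)` generating the unit ideal.  The projective
line `ℙ¹(𝔽_p[ε])` is the quotient of this set by unit scaling, so functions on `ℙ¹(𝔽_p[ε])`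
are the same as scaling-invariant functions on unimodular pairs. -/
def UniPair (p m : ℕ) : Type :=
  {v : DualNum p m × DualNum p m // ∃ a b : DualNum p m, a * v.1 + b * v.2 = 1}

namespace DualNum

variable {p m : ℕ}

theorem pow_eq_zero_of_mem_span_eps {w : DualNum p m} (hw : w ∈ Ideal.span {eps p m}) {n : ℕ}
    (hn : m + 1 ≤ n) : w ^ n = 0 := by
  obtain ⟨a, rfl⟩ := Ideal.mem_span_singleton.1 hw
  have h : eps p m ^ (m + 1) = 0 := by
    rw [eps, ← map_pow, Ideal.Quotient.eq_zero_iff_mem]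
    exact Ideal.mem_span_singleton_self _
  exact pow_eq_zero_of_le hn (by rw [mul_pow, h, zero_mul])

theorem exists_eq_algebraMap_add (z : DualNum p m) :
    ∃ c : ZMod p, ∃ w ∈ Ideal.span {eps p m}, z = algebraMap (ZMod p) (DualNum p m) c + w := by
  obtain ⟨f, rfl⟩ := Ideal.Quotient.mk_surjective z
  refine ⟨f.coeff 0, eps p m * Ideal.Quotient.mk _ f.divX,
    Ideal.mul_mem_right _ _ (Ideal.mem_span_singleton_self _), ?_⟩
  conv_lhs => rw [← Polynomial.X_mul_divX_add f]
  rw [map_add, map_mul, add_comm]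
  rfl

variable [Fact p.Prime]

instance : Nontrivial (DualNum p m) := by
  refine Ideal.Quotient.nontrivial_iff.2 fun h => ?_
  rw [Ideal.span_singleton_eq_top] at h
  exact Polynomial.not_isUnit_X (isUnit_of_dvd_unit (dvd_pow_self _ m.succ_ne_zero) h)

instance : CharP (DualNum p m) p :=
  charP_of_injective_algebraMap (algebraMap (ZMod p) (DualNum p m)).injective p

theorem isUnit_algebraMap_add {c : ZMod p} (hc : c ≠ 0) {w : DualNum p m}
    (hw : w ∈ Ideal.span {eps p m}) : IsUnit (algebraMap (ZMod p) (DualNum p m) c + w) :=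
  IsNilpotent.isUnit_add_left_of_commute ⟨m + 1, pow_eq_zero_of_mem_span_eps hw le_rfl⟩
    ((isUnit_iff_ne_zero.2 hc).map _) (Commute.all _ _)

theorem not_isUnit_of_mem_span_eps {w : DualNum p m} (hw : w ∈ Ideal.span {eps p m}) :
    ¬ IsUnit w := fun h => by
  have := h.pow (m + 1)
  rw [pow_eq_zero_of_mem_span_eps hw le_rfl] at this
  exact not_isUnit_zero this

theorem unit_pow_eq_one {r : ℕ} (hm : m ≤ p - 1) (hr : p * (p - 1) ∣ r) (u : (DualNum p m)ˣ) :
    (u : DualNum p m) ^ r = 1 := by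
  obtain ⟨c, w, hw, h⟩ := exists_eq_algebraMap_add (u : DualNum p m)
  have hc : c ≠ 0 := by
    rintro rfl
    rw [map_zero, zero_add] at h
    exact not_isUnit_of_mem_span_eps hw (h ▸ u.isUnit)
  have hp := (Fact.out : p.Prime).pos
  obtain ⟨k, rfl⟩ := hr
  rw [pow_mul, pow_mul, h, add_pow_char, pow_eq_zero_of_mem_span_eps hw (by omega), add_zero,
    ← map_pow, ZMod.pow_card, ← map_pow, ZMod.pow_card_sub_one_eq_one hc, map_one, one_pow]

end DualNum

open DualNum

theorem UniPair.exists_normal_form {p m : ℕ} [Fact p.Prime] (v : UniPair p m) :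
    ∃ u : (DualNum p m)ˣ, ∃ w ∈ Ideal.span {eps p m},
      (∃ z₀ : ZMod p, v.1.1 = u * (algebraMap (ZMod p) (DualNum p m) z₀ + w) ∧ v.1.2 = u * 1) ∨
        (v.1.1 = u * 1 ∧ v.1.2 = u * w) := by
  obtain ⟨⟨c, d⟩, a, b, hab⟩ := v
  dsimp only at hab ⊢
  obtain ⟨c₀, y, hy, hc⟩ := exists_eq_algebraMap_add c
  obtain ⟨d₀, x, hx, hd⟩ := exists_eq_algebraMap_add d
  by_cases hd₀ : d₀ = 0
  · subst hd₀
    rw [map_zero, zero_add] at hd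
    subst hd
    have hc₀ : c₀ ≠ 0 := by
      rintro rfl
      rw [map_zero, zero_add] at hc
      subst hc
      exact not_isUnit_of_mem_span_eps
        (add_mem (Ideal.mul_mem_left _ a hy) (Ideal.mul_mem_left _ b hx)) (hab ▸ isUnit_one)
    obtain ⟨u, hu⟩ := isUnit_algebraMap_add hc₀ hy
    refine ⟨u, ↑u⁻¹ * d, Ideal.mul_mem_left _ _ hx, Or.inr ⟨?_, ?_⟩⟩
    · rw [hc, hu, mul_one]
    · rw [Units.mul_inv_cancel_left]
  · obtain ⟨u, hu⟩ := isUnit_algebraMap_add hd₀ hx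
    obtain ⟨z₀, w, hw, hz⟩ := exists_eq_algebraMap_add ((↑u⁻¹ : DualNum p m) * c)
    refine ⟨u, w, hw, Or.inl ⟨z₀, ?_, ?_⟩⟩
    · rw [← hz, Units.mul_inv_cancel_left]
    · rw [hd, hu, mul_one]

theorem aeval_pair_mul {R A : Type*} [CommRing R] [CommRing A] [Algebra R A] {r : ℕ}
    {P : MvPolynomial (Fin 2) R} (hP : P.IsHomogeneous r) (u c d : A) :
    aeval ![u * c, u * d] P = u ^ r * aeval ![c, d] P := by
  have h : ![u * c, u * d] = u • ![c, d] := by simp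
  rw [h]
  simp only [aeval_def, eval₂_eq, Finset.mul_sum, Pi.smul_apply, smul_eq_mul, mul_pow,
    Finset.prod_mul_distrib, Finset.prod_pow_eq_pow_sum]
  refine Finset.sum_congr rfl fun i hi => ?_
  have hi' := hP.degree_eq_sum_deg_support hi
  rw [← hi']
  ring

theorem aeval_eq_sum_of_mem_span_eps {p m : ℕ} (f : Polynomial (ZMod p)) {w : DualNum p m}
    (hw : w ∈ Ideal.span {eps p m}) :
    Polynomial.aeval w f =
      ∑ j : Fin (m + 1), w ^ (j : ℕ) * algebraMap (ZMod p) (DualNum p m) (f.coeff j) := by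
  rw [Fin.sum_univ_eq_sum_range
    (fun j => w ^ j * algebraMap (ZMod p) (DualNum p m) (f.coeff j)) (m + 1),
    Polynomial.aeval_eq_sum_range' (n := max (f.natDegree + 1) (m + 1)) (by omega)]
  simp_rw [Algebra.smul_def, mul_comm (algebraMap _ _ _)]
  symm
  refine Finset.sum_subset (Finset.range_subset_range.2 (le_max_right _ _)) fun j _ hj => ?_
  rw [pow_eq_zero_of_mem_span_eps hw (by simpa using hj), zero_mul]

theorem exists_sum_div_factorial_eq_aeval {p m : ℕ} [Fact p.Prime] (hm : m ≤ p - 1)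
    (f : Polynomial (ZMod p)) :
    ∃ hc : Fin (m + 1) → ZMod p, ∀ w : DualNum p m, w ∈ Ideal.span {eps p m} →
      Polynomial.aeval w f = ∑ j : Fin (m + 1), w ^ (j : ℕ) *
        algebraMap (ZMod p) (DualNum p m) (hc j / (Nat.factorial (j : ℕ) : ZMod p)) := by
  have hp := (Fact.out : p.Prime)
  refine ⟨fun j => f.coeff j * (Nat.factorial (j : ℕ) : ZMod p), fun w hw => ?_⟩
  rw [aeval_eq_sum_of_mem_span_eps f hw]
  refine Finset.sum_congr rfl fun j _ => ?_
  rw [mul_div_cancel_right₀]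
  rw [Ne, ZMod.natCast_eq_zero_iff, hp.dvd_factorial]
  have := hp.pos
  omega

theorem exists_hermite_interpolation {F : Type*} [Field F] [Fintype F] (n : ℕ)
    (q : F → Polynomial F) :
    ∃ g : Polynomial F, g.degree < ((Fintype.card F * n : ℕ) : WithBot ℕ) ∧
      ∀ z, (Polynomial.X - Polynomial.C z) ^ n ∣ g - q z := by
  classical
  have hcop : Pairwise (Function.onFun IsCoprime
      fun z : F => Ideal.span {(Polynomial.X - Polynomial.C z) ^ n}) := fun a b hab => by
    rw [Function.onFun, Ideal.isCoprime_span_singleton_iff]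
    exact (Polynomial.pairwise_coprime_X_sub_C Function.injective_id hab).pow
  obtain ⟨g, hg⟩ := Ideal.exists_forall_sub_mem_ideal hcop q
  set M : Polynomial F := ∏ z : F, (Polynomial.X - Polynomial.C z) ^ n
  have hM : M.Monic :=
    Polynomial.monic_prod_of_monic _ _ fun z _ => (Polynomial.monic_X_sub_C z).pow n
  have hdeg : M.natDegree = Fintype.card F * n := by
    rw [Polynomial.natDegree_prod_of_monic _ _ fun z _ => (Polynomial.monic_X_sub_C z).pow n]
    simp
  refine ⟨g %ₘ M, ?_, fun z => ?_⟩
  · rw [← hdeg, ← Polynomial.degree_eq_natDegree hM.ne_zero]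
    exact Polynomial.degree_modByMonic_lt g hM
  · have h1 := Ideal.mem_span_singleton.1 (hg z)
    have h2 : (Polynomial.X - Polynomial.C z) ^ n ∣ M :=
      Finset.dvd_prod_of_mem (fun z : F => (Polynomial.X - Polynomial.C z) ^ n)
        (Finset.mem_univ z)
    have h3 : g %ₘ M - q z = (g - q z) - M * (g /ₘ M) := by
      rw [Polynomial.modByMonic_eq_sub_mul_div]; ring
    rw [h3]
    exact dvd_sub h1 (h2.mul_right _)

theorem exists_isHomogeneous_of_local_expansions {p m r : ℕ} [Fact p.Prime]
    (hrbig : (m + 1) * (p + 1) ≤ r) (a : ZMod p → Fin (m + 1) → ZMod p)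
    (b : Fin (m + 1) → ZMod p) :
    ∃ P : MvPolynomial (Fin 2) (ZMod p), P.IsHomogeneous r ∧
      ∀ w : DualNum p m, w ∈ Ideal.span {eps p m} →
        (∀ z₀, aeval ![algebraMap (ZMod p) (DualNum p m) z₀ + w, 1] P =
          ∑ j : Fin (m + 1), w ^ (j : ℕ) * algebraMap (ZMod p) (DualNum p m) (a z₀ j)) ∧
        aeval ![1, w] P =
          ∑ j : Fin (m + 1), w ^ (j : ℕ) * algebraMap (ZMod p) (DualNum p m) (b j) := by
  obtain ⟨g, hgdeg, hg⟩ := exists_hermite_interpolation (F := ZMod p) (m + 1) fun z =>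
    (∑ j : Fin (m + 1), Polynomial.C (a z j) * (Polynomial.X - Polynomial.C z) ^ (j : ℕ)) -
      ∑ j : Fin (m + 1), Polynomial.C (b j) * Polynomial.X ^ (r - j : ℕ)
  rw [ZMod.card] at hgdeg
  have hNr : p * (m + 1) + (m + 1) ≤ r := by linarith
  refine ⟨(∑ j : Fin (m + 1), C (b j) * (X 0 ^ (r - j : ℕ) * X 1 ^ (j : ℕ))) +
    ∑ i ∈ Finset.range (p * (m + 1)), C (g.coeff i) * (X 0 ^ i * X 1 ^ (r - i)), ?_, ?_⟩
  · have key (c : ZMod p) (i j : ℕ) (h : i + j = r) :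
        (C c * (X 0 ^ i * X 1 ^ j) : MvPolynomial (Fin 2) (ZMod p)).IsHomogeneous r := by
      have := (isHomogeneous_C (Fin 2) c).mul
        (((isHomogeneous_X (ZMod p) (0 : Fin 2)).pow i).mul
          ((isHomogeneous_X (ZMod p) (1 : Fin 2)).pow j))
      rwa [one_mul, one_mul, zero_add, h] at this
    refine IsHomogeneous.add (IsHomogeneous.sum _ _ _ fun j _ => key _ _ _ ?_)
      (IsHomogeneous.sum _ _ _ fun i hi => key _ _ _ ?_)
    · omega
    · rw [Finset.mem_range] at hi
      omega
  · refine fun w hw => ⟨fun z₀ => ?_, ?_⟩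
    · obtain ⟨k, hk⟩ := hg z₀
      have h := congrArg (Polynomial.aeval (algebraMap (ZMod p) (DualNum p m) z₀ + w)) hk
      have hsum : Polynomial.aeval (algebraMap (ZMod p) (DualNum p m) z₀ + w) g =
          ∑ i ∈ Finset.range (p * (m + 1)), algebraMap (ZMod p) (DualNum p m) (g.coeff i) *
            (algebraMap (ZMod p) (DualNum p m) z₀ + w) ^ i := by
        conv_lhs => rw [g.as_sum_range' (p * (m + 1))
          (by
            by_cases h0 : g = 0
            · have := (Fact.out : p.Prime).pos
              subst h0
              simpa using this
            · exact (Polynomial.natDegree_lt_iff_degree_lt h0).2 hgdeg)]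
        simp [Polynomial.aeval_monomial]
      simp only [map_sub, map_mul, map_pow, map_sum, Polynomial.aeval_X, Polynomial.aeval_C,
        add_sub_cancel_left, pow_eq_zero_of_mem_span_eps hw le_rfl, zero_mul, hsum] at h
      simp only [map_add, map_sum, map_mul, map_pow, aeval_X, algHom_C, Matrix.cons_val_zero,
        Matrix.cons_val_one, one_pow, mul_one]
      simp only [mul_comm (w ^ _)]
      linear_combination h
    · have h0 : ∑ i ∈ Finset.range (p * (m + 1)),
          algebraMap (ZMod p) (DualNum p m) (g.coeff i) * w ^ (r - i) = 0 :=
        Finset.sum_eq_zero fun i hi => by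
          rw [Finset.mem_range] at hi
          rw [pow_eq_zero_of_mem_span_eps hw (by omega), mul_zero]
      simp only [map_add, map_sum, map_mul, map_pow, aeval_X, algHom_C, Matrix.cons_val_zero,
        Matrix.cons_val_one, one_pow, one_mul]
      rw [h0, add_zero]
      simp only [mul_comm (w ^ _)]

/-- for `0 ≤ m ≤ p−1`, `r ≥ (m+1)(p+1)` and `p(p−1) ∣ r`, the image of the map
`ψ : V_r → (functions on ℙ¹(𝔽_p[ε]))`, `P ↦ ([c:d] ↦ P(c,d))`, is exactly the set of
(scaling-invariant) functions `h` that take values in `𝔽_p` on `ℙ¹(𝔽_p)` and are smooth. -/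
theorem image_of_psi_dual_numbers (p : ℕ) [Fact p.Prime] (m r : ℕ)
    (hm : m ≤ p - 1) (hrbig : (m + 1) * (p + 1) ≤ r) (hr : p * (p - 1) ∣ r) :
    {h : UniPair p m → DualNum p m |
        ∃ P ∈ homogeneousSubmodule (Fin 2) (ZMod p) r,
          ∀ v : UniPair p m, h v = aeval ![v.1.1, v.1.2] P} =
    {h : UniPair p m → DualNum p m |
        -- `h` is invariant under unit scaling (i.e. descends to `ℙ¹(𝔽_p[ε])`)
        (∀ (u : (DualNum p m)ˣ) (v w : UniPair p m),
            w.1.1 = (u : DualNum p m) * v.1.1 → w.1.2 = (u : DualNum p m) * v.1.2 →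
              h w = h v) ∧
        -- `h` takes values in `𝔽_p` on points of `ℙ¹(𝔽_p) ⊆ ℙ¹(𝔽_p[ε])`
        (∀ v : UniPair p m,
            (∃ c d : ZMod p, v.1.1 = algebraMap (ZMod p) (DualNum p m) c ∧
                v.1.2 = algebraMap (ZMod p) (DualNum p m) d) →
              h v ∈ Set.range (algebraMap (ZMod p) (DualNum p m))) ∧
        -- `h` is smooth: on the affine chart `[z₀ + w : 1]` ...
        (∀ z₀ : ZMod p, ∃ hc : Fin (m + 1) → ZMod p,
            ∀ w : DualNum p m, w ∈ Ideal.span {eps p m} →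
              h ⟨(algebraMap (ZMod p) (DualNum p m) z₀ + w, 1),
                  ⟨0, 1, by ring⟩⟩ =
                ∑ j : Fin (m + 1),
                  w ^ (j : ℕ) *
                    algebraMap (ZMod p) (DualNum p m)
                      (hc j / (Nat.factorial (j : ℕ) : ZMod p))) ∧
        -- ... and at infinity `[1 : w]`
        (∃ kc : Fin (m + 1) → ZMod p,
            ∀ w : DualNum p m, w ∈ Ideal.span {eps p m} →
              h ⟨(1, w), ⟨1, 0, by ring⟩⟩ =
                ∑ j : Fin (m + 1),
                  w ^ (j : ℕ) *
                    algebraMap (ZMod p) (DualNum p m)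
                      (kc j / (Nat.factorial (j : ℕ) : ZMod p)))} := by
  ext h
  constructor
  · rintro ⟨P, hP, hh⟩
    rw [mem_homogeneousSubmodule] at hP
    refine ⟨fun u v w h1 h2 => ?_, ?_, fun z₀ => ?_, ?_⟩
    · rw [hh, hh, h1, h2, aeval_pair_mul hP, unit_pow_eq_one hm hr, one_mul]
    · rintro v ⟨c, d, hc, hd⟩
      refine ⟨aeval ![c, d] P, ?_⟩
      rw [hh, hc, hd, ← aeval_algebraMap_apply]
      congr 2
      ext i
      fin_cases i <;> rfl
    · obtain ⟨hc, hhc⟩ := exists_sum_div_factorial_eq_aeval hm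
        (aeval ![Polynomial.C z₀ + Polynomial.X, 1] P)
      refine ⟨hc, fun w hw => ?_⟩
      refine (hh _).trans ?_
      rw [← hhc w hw, comp_aeval_apply]
      congr 2
      ext i
      fin_cases i <;> simp
    · obtain ⟨kc, hkc⟩ := exists_sum_div_factorial_eq_aeval hm (aeval ![1, Polynomial.X] P)
      refine ⟨kc, fun w hw => ?_⟩
      refine (hh _).trans ?_
      rw [← hkc w hw, comp_aeval_apply]
      congr 2
      ext i
      fin_cases i <;> simp
  · rintro ⟨hinv, -, hfin, kc, hkc⟩
    choose hc hhc using hfin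
    obtain ⟨P, hP, hPw⟩ := exists_isHomogeneous_of_local_expansions hrbig
      (fun z₀ j => hc z₀ j / (Nat.factorial (j : ℕ) : ZMod p))
      (fun j => kc j / (Nat.factorial (j : ℕ) : ZMod p))
    refine ⟨P, hP, fun v => ?_⟩
    obtain ⟨u, w, hw, ⟨z₀, h1, h2⟩ | ⟨h1, h2⟩⟩ := v.exists_normal_form
    · rw [h1, h2, aeval_pair_mul hP, unit_pow_eq_one hm hr, one_mul, (hPw w hw).1 z₀,
        ← hhc z₀ w hw]
      exact hinv u _ v h1 h2
    · rw [h1, h2, aeval_pair_mul hP, unit_pow_eq_one hm hr, one_mul, (hPw w hw).2, ← hkc w hw]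
      exact hinv u _ v h1 h2
end

section
/- Let p be an odd prime, let 0 ≤ k ≤ p−2 and let −1 ≤ r ≤ p−3−k. Then there is a G-equivariant 𝔽_{p²}-linear isomorphism ((V_{r+(k+1)(p+1)} / D(V_{r+2+k(p+1)})) ⊗ V_{p−1}) ⊗_{𝔽_p} 𝔽_{p²} ≅ ind_T^G ω₂^{r+2+k(p+1)}. -/
open MvPolynomial

noncomputable section

/-- `P ∈ 𝔽_{p²}[X,Y,S,T]` (with `X = X(0,0)`, `Y = X(0,1)`, `S = X(1,0)`, `T = X(1,1)`)
is bihomogeneous of bidegree `(n₁, n₂)`; this models `V_{n₁} ⊗ V_{n₂}` after scalar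
extension. -/
def IsBiHom {K : Type*} [CommRing K] (n₁ n₂ : ℕ)
    (P : MvPolynomial (Fin 2 × Fin 2) K) : Prop :=
  ∀ dd ∈ P.support, dd (0, 0) + dd (0, 1) = n₁ ∧ dd (1, 0) + dd (1, 1) = n₂

/-- Serre's operator `D = X^p ∂/∂X + Y^p ∂/∂Y`, acting on the `(X,Y)`-variables. -/
def DK (p : ℕ) (K : Type*) [CommRing K] :
    Module.End K (MvPolynomial (Fin 2 × Fin 2) K) :=
  (LinearMap.mulLeft K ((X (0, 0) : MvPolynomial (Fin 2 × Fin 2) K) ^ p)) ∘ₗ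
      (pderiv ((0, 0) : Fin 2 × Fin 2)).toLinearMap +
    (LinearMap.mulLeft K ((X (0, 1) : MvPolynomial (Fin 2 × Fin 2) K) ^ p)) ∘ₗ
      (pderiv ((0, 1) : Fin 2 × Fin 2)).toLinearMap

/-- The action of `g = [[a,b],[c,d]] ∈ GL₂(𝔽_p)` on `𝔽_{p²}[X,Y,S,T]`, acting by the
standard substitution simultaneously on `(X,Y)` and on `(S,T)`. -/
def actK (p : ℕ) (K : Type*) [CommRing K] [Algebra (ZMod p) K]
    (g : Matrix (Fin 2) (Fin 2) (ZMod p)) :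
    MvPolynomial (Fin 2 × Fin 2) K →ₗ[K] MvPolynomial (Fin 2 × Fin 2) K :=
  (aeval fun v : Fin 2 × Fin 2 =>
    C (algebraMap (ZMod p) K (g 0 v.2)) * X (v.1, 0) +
      C (algebraMap (ZMod p) K (g 1 v.2)) * X (v.1, 1)).toLinearMap

end

section Monomials

variable {K : Type*} [Field K]

/-- The monomial `X^i Y^j S^d T^e`. -/
noncomputable def biMon (K : Type*) [Field K] (i j d e : ℕ) : MvPolynomial (Fin 2 × Fin 2) K :=
  X (0, 0) ^ i * X (0, 1) ^ j * X (1, 0) ^ d * X (1, 1) ^ e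

/-- The span of the monomials of bidegree `(n₁, n₂)`. -/
noncomputable def biHom (K : Type*) [Field K] (n₁ n₂ : ℕ) :
    Submodule K (MvPolynomial (Fin 2 × Fin 2) K) :=
  Submodule.span K {P | ∃ i j d e, i + j = n₁ ∧ d + e = n₂ ∧ biMon K i j d e = P}

/-- The Dickson invariant `X Y^p - X^p Y`. -/
noncomputable def dickson (p : ℕ) (K : Type*) [Field K] : MvPolynomial (Fin 2 × Fin 2) K :=
  X (0, 0) * X (0, 1) ^ p - X (0, 0) ^ p * X (0, 1)

lemma monomial_eq_smul_biMon (s : Fin 2 × Fin 2 →₀ ℕ) (a : K) :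
    monomial s a = a • biMon K (s (0, 0)) (s (0, 1)) (s (1, 0)) (s (1, 1)) := by
  rw [monomial_eq, Finsupp.prod_fintype _ _ (by simp), Fintype.prod_prod_type, smul_eq_C_mul, biMon]
  simp [Fin.prod_univ_two, mul_assoc]

lemma biMon_mem_biHom {i j d e n₁ n₂ : ℕ} (h₁ : i + j = n₁) (h₂ : d + e = n₂) :
    biMon K i j d e ∈ biHom K n₁ n₂ :=
  Submodule.subset_span ⟨i, j, d, e, h₁, h₂, rfl⟩

lemma isBiHom_biMon (i j d e : ℕ) : IsBiHom (i + j) (d + e) (biMon K i j d e) := by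
  have h : biMon K i j d e = monomial (Finsupp.single (0, 0) i + Finsupp.single (0, 1) j +
      Finsupp.single (1, 0) d + Finsupp.single (1, 1) e) 1 := by
    rw [monomial_eq_smul_biMon]
    simp
  intro s hs
  rw [h] at hs
  have := Finset.mem_singleton.1 (support_monomial_subset hs)
  subst this
  simp

lemma isBiHom_iff_mem {n₁ n₂ : ℕ} {P : MvPolynomial (Fin 2 × Fin 2) K} :
    IsBiHom n₁ n₂ P ↔ P ∈ biHom K n₁ n₂ := by
  constructor
  · intro h
    rw [P.as_sum]
    refine Submodule.sum_mem _ fun s hs => ?_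
    rw [monomial_eq_smul_biMon]
    exact Submodule.smul_mem _ _ (biMon_mem_biHom (h s hs).1 (h s hs).2)
  · intro h
    induction h using Submodule.span_induction with
    | mem P hP =>
      obtain ⟨i, j, d, e, rfl, rfl, rfl⟩ := hP
      exact isBiHom_biMon i j d e
    | zero => intro s hs; simp at hs
    | add P Q _ _ hP hQ =>
      intro s hs
      rcases Finset.mem_union.1 (support_add hs) with hs | hs
      exacts [hP s hs, hQ s hs]
    | smul a P _ hP => exact fun s hs => hP s (support_smul hs)

lemma DK_biMon (p i j d e : ℕ) :
    DK p K (biMon K i j d e) =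
      (i : K) • biMon K (i - 1 + p) j d e + (j : K) • biMon K i (j - 1 + p) d e := by
  simp only [DK, biMon, LinearMap.add_apply, LinearMap.comp_apply, Derivation.coeFn_coe,
    Derivation.leibniz, Derivation.leibniz_pow, pderiv_X, LinearMap.mulLeft_apply, smul_eq_C_mul,
    map_natCast]
  simp [pow_add]
  ring

lemma dickson_mul_biMon (p i j d e : ℕ) :
    dickson p K * biMon K i j d e =
      biMon K (i + 1) (j + p) d e - biMon K (i + p) (j + 1) d e := by
  simp only [dickson, biMon, pow_add]
  ring

lemma dickson_mul_mem (p : ℕ) {n₁ n₂ : ℕ} {P : MvPolynomial (Fin 2 × Fin 2) K}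
    (hP : P ∈ biHom K n₁ n₂) : dickson p K * P ∈ biHom K (n₁ + (p + 1)) n₂ := by
  induction hP using Submodule.span_induction with
  | mem P hP =>
    obtain ⟨i, j, d, e, rfl, rfl, rfl⟩ := hP
    rw [dickson_mul_biMon]
    exact Submodule.sub_mem _ (biMon_mem_biHom (by ring) rfl) (biMon_mem_biHom (by ring) rfl)
  | zero => simp
  | add P Q _ _ hP hQ => rw [mul_add]; exact Submodule.add_mem _ hP hQ
  | smul a P _ hP => rw [mul_smul_comm]; exact Submodule.smul_mem _ _ hP

lemma dickson_pow_mul_mem (p k : ℕ) {n₁ n₂ : ℕ} {P : MvPolynomial (Fin 2 × Fin 2) K}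
    (hP : P ∈ biHom K n₁ n₂) : dickson p K ^ k * P ∈ biHom K (n₁ + k * (p + 1)) n₂ := by
  induction k with
  | zero => simpa using hP
  | succ k ih =>
    have := dickson_mul_mem p ih
    rwa [← mul_assoc, ← pow_succ', add_assoc, ← Nat.succ_mul] at this

lemma DK_dickson_mul (p : ℕ) [CharP K p] (P : MvPolynomial (Fin 2 × Fin 2) K) :
    DK p K (dickson p K * P) = dickson p K * DK p K P := by
  simp only [DK, dickson, LinearMap.add_apply, LinearMap.comp_apply, Derivation.coeFn_coe, map_sub,
    Derivation.leibniz, Derivation.leibniz_pow, pderiv_X, LinearMap.mulLeft_apply]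
  simp
  ring

lemma map_DK_le_comap_dickson (p m n : ℕ) [CharP K p] :
    (biHom K m n).map (DK p K) ≤
      ((biHom K (m + (p + 1)) n).map (DK p K)).comap (LinearMap.mulLeft K (dickson p K)) := by
  rintro _ ⟨P, hP, rfl⟩
  exact ⟨dickson p K * P, dickson_mul_mem p hP, DK_dickson_mul p P⟩

/-- Representatives of a basis of `V_{m+p-1+k(p+1)} ⊗ V_{p-1}` modulo the image of `D`. -/
noncomputable def cuspRep (p : ℕ) (K : Type*) [Field K] (k m : ℕ) (c : Fin (p - 1) × Fin p) :
    MvPolynomial (Fin 2 × Fin 2) K :=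
  dickson p K ^ k * biMon K (c.1 + 1) (m + (p - 1) - (c.1 + 1)) c.2 (p - 1 - c.2)

lemma cuspRep_mem (p : ℕ) {k m : ℕ} (hm : 1 ≤ m) (c : Fin (p - 1) × Fin p) :
    cuspRep p K k m c ∈ biHom K (m + (p - 1) + k * (p + 1)) (p - 1) :=
  dickson_pow_mul_mem p k (biMon_mem_biHom (by omega) (by omega))

lemma biMon_mem_span_cuspRep_zero (p : ℕ) [CharP K p] {m i j d e : ℕ} (hm : 1 ≤ m)
    (hmp : m ≤ p - 1) (hij : i + j = m + (p - 1)) (hde : d + e = p - 1) :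
    biMon K i j d e ∈ Submodule.span K (Set.range (cuspRep p K 0 m)) ⊔
      (biHom K m (p - 1)).map (DK p K) := by
  have hcast : ∀ a : ℕ, 1 ≤ a → a ≤ p - 1 → (a : K) ≠ 0 := fun a h₁ h₂ h =>
    Nat.not_dvd_of_pos_of_lt h₁ (by omega) ((CharP.cast_eq_zero_iff K p a).1 h)
  have hmid : ∀ i j, 1 ≤ i → i ≤ p - 1 → i + j = m + (p - 1) →
      biMon K i j d e ∈ Submodule.span K (Set.range (cuspRep p K 0 m)) := by
    intro i j h₁ h₂ hij
    refine Submodule.subset_span ⟨(⟨i - 1, by omega⟩, ⟨d, by omega⟩), ?_⟩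
    simp only [cuspRep, pow_zero, one_mul]
    congr 1 <;> omega
  have hD : ∀ i j, i + j = m → DK p K (biMon K i j d e) ∈ (biHom K m (p - 1)).map (DK p K) :=
    fun i j h => ⟨_, biMon_mem_biHom h hde, rfl⟩
  rcases Nat.eq_zero_or_pos i with rfl | hi
  · refine Submodule.mem_sup_right ?_
    have h := hD 0 m (by omega)
    rw [DK_biMon, Nat.cast_zero, zero_smul, zero_add] at h
    rw [← Submodule.smul_mem_iff _ (hcast m hm hmp)]
    convert h using 3
    omega
  rcases Nat.lt_or_ge (p - 1) i with hip | hip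
  · have h := hD (i - (p - 1)) j (by omega)
    rw [DK_biMon] at h
    rw [← Submodule.smul_mem_iff _ (hcast (i - (p - 1)) (by omega) (by omega))]
    have hj : (j : K) • biMon K (i - (p - 1)) (j - 1 + p) d e ∈
        Submodule.span K (Set.range (cuspRep p K 0 m)) := by
      rcases Nat.eq_zero_or_pos j with rfl | hj
      · simp
      · exact Submodule.smul_mem _ _ (hmid _ _ (by omega) (by omega) (by omega))
    have h' := Submodule.sub_mem _ (Submodule.mem_sup_right h) (Submodule.mem_sup_left hj)
    rw [add_sub_cancel_right] at h'
    convert h' using 3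
    omega
  · exact Submodule.mem_sup_left (hmid i j hi hip hij)

lemma biMon_mem_span_cuspRep (p : ℕ) [CharP K p] {m : ℕ} (hm : 1 ≤ m) (k : ℕ)
    (hmk : m + k ≤ p - 1) {i j d e : ℕ} (hij : i + j = m + (p - 1) + k * (p + 1))
    (hde : d + e = p - 1) :
    biMon K i j d e ∈ Submodule.span K (Set.range (cuspRep p K k m)) ⊔
      (biHom K (m + k * (p + 1)) (p - 1)).map (DK p K) := by
  induction k generalizing i j with
  | zero => simpa using biMon_mem_span_cuspRep_zero p hm hmk (by simpa using hij) hde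
  | succ k ih =>
    set N := Submodule.span K (Set.range (cuspRep p K (k + 1) m)) ⊔
      (biHom K (m + (k + 1) * (p + 1)) (p - 1)).map (DK p K) with hN
    have hk : (k + 1) * (p + 1) = k * (p + 1) + (p + 1) := by ring
    have hcast : ((m + (k + 1) * (p + 1) : ℕ) : K) ≠ 0 := by
      rw [show m + (k + 1) * (p + 1) = m + (k + 1) + (k + 1) * p by ring, Nat.cast_add,
        Nat.cast_mul, CharP.cast_eq_zero K p, mul_zero, add_zero]
      exact fun h => Nat.not_dvd_of_pos_of_lt (by omega) (by omega)
        ((CharP.cast_eq_zero_iff K p _).1 h)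
    have hθ : ∀ i j, i + j = m + (p - 1) + k * (p + 1) → dickson p K * biMon K i j d e ∈ N := by
      intro i j h
      have hle : Submodule.span K (Set.range (cuspRep p K k m)) ⊔
          (biHom K (m + k * (p + 1)) (p - 1)).map (DK p K) ≤
          N.comap (LinearMap.mulLeft K (dickson p K)) := by
        refine sup_le (Submodule.span_le.2 ?_) ((map_DK_le_comap_dickson p _ _).trans
          (Submodule.comap_mono ?_))
        · rintro _ ⟨c, rfl⟩
          have hc : LinearMap.mulLeft K (dickson p K) (cuspRep p K k m c) =
              cuspRep p K (k + 1) m c := by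
            rw [cuspRep, cuspRep, pow_succ', mul_assoc, LinearMap.mulLeft_apply]
          rw [SetLike.mem_coe, Submodule.mem_comap, hc]
          exact Submodule.mem_sup_left (Submodule.subset_span (Set.mem_range_self c))
        · rw [hN, hk, add_assoc]
          exact le_sup_right
      exact hle (ih (by omega) h)
    have hD : ∀ i j, i + j = m + (k + 1) * (p + 1) → DK p K (biMon K i j d e) ∈ N :=
      fun i j h => Submodule.mem_sup_right ⟨_, biMon_mem_biHom h hde, rfl⟩
    have hmid : ∀ i j, 1 ≤ i → p ≤ j → i + j = m + (p - 1) + (k + 1) * (p + 1) →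
        biMon K i j d e ∈ N := by
      intro i j hi hj hij
      obtain ⟨i, rfl⟩ := Nat.exists_eq_add_of_le' hi
      obtain ⟨j, rfl⟩ := Nat.exists_eq_add_of_le' hj
      rw [← Submodule.smul_mem_iff _ hcast]
      have h := N.add_mem (hD (i + 1) (j + 1) (by omega))
        (N.smul_mem ((i + 1 : ℕ) : K) (hθ i j (by omega)))
      rw [DK_biMon, dickson_mul_biMon, Nat.add_sub_cancel, Nat.add_sub_cancel] at h
      rw [show m + (k + 1) * (p + 1) = (i + 1) + (j + 1) by omega, Nat.cast_add, add_smul]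
      rw [smul_sub] at h
      convert h using 1
      abel
    rcases Nat.eq_zero_or_pos i with rfl | hi
    · have h := hD 0 (m + (k + 1) * (p + 1)) (by omega)
      rw [DK_biMon, Nat.cast_zero, zero_smul, zero_add] at h
      rw [← Submodule.smul_mem_iff _ hcast]
      convert h using 3
      omega
    rcases Nat.lt_or_ge j p with hj | hj
    · rcases Nat.eq_zero_or_pos j with rfl | hj0
      · have h := hD (m + (k + 1) * (p + 1)) 0 (by omega)
        rw [DK_biMon, Nat.cast_zero, zero_smul, add_zero] at h
        rw [← Submodule.smul_mem_iff _ hcast]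
        convert h using 3
        omega
      · obtain ⟨j, rfl⟩ := Nat.exists_eq_add_of_le' hj0
        have h := N.sub_mem (hmid (i - p + 1) (j + p) (by omega) (by omega) (by omega))
          (hθ (i - p) j (by omega))
        rw [dickson_mul_biMon, sub_sub_cancel, Nat.sub_add_cancel (by omega)] at h
        exact h
    · exact hmid i j hi hj hij

lemma exists_cuspRep_add_DK (p : ℕ) [CharP K p] {m : ℕ} (hm : 1 ≤ m) {k : ℕ}
    (hmk : m + k ≤ p - 1) {R : MvPolynomial (Fin 2 × Fin 2) K}
    (hR : R ∈ biHom K (m + (p - 1) + k * (p + 1)) (p - 1)) :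
    ∃ c : Fin (p - 1) × Fin p → K, ∃ S ∈ biHom K (m + k * (p + 1)) (p - 1),
      R = ∑ q, c q • cuspRep p K k m q + DK p K S := by
  have hle : biHom K (m + (p - 1) + k * (p + 1)) (p - 1) ≤
      Submodule.span K (Set.range (cuspRep p K k m)) ⊔
        (biHom K (m + k * (p + 1)) (p - 1)).map (DK p K) := by
    refine Submodule.span_le.2 ?_
    rintro _ ⟨i, j, d, e, h₁, h₂, rfl⟩
    exact biMon_mem_span_cuspRep p hm k hmk h₁ h₂
  obtain ⟨A, hA, _, ⟨S, hS, rfl⟩, rfl⟩ := Submodule.mem_sup.1 (hle hR)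
  obtain ⟨c, rfl⟩ := (Submodule.mem_span_range_iff_exists_fun K).1 hA
  exact ⟨c, S, hS, rfl⟩

end Monomials

section ConjLin

variable {p : ℕ} {K : Type*} [Field K]

/-- The linear polynomial `x Z - x^p`. -/
noncomputable def conjLin (p : ℕ) {K : Type*} [Field K] (x : K) : Polynomial K :=
  Polynomial.C x * Polynomial.X - Polynomial.C (x ^ p)

lemma natDegree_conjLin_mul_le (x y : K) (i j : ℕ) :
    (conjLin p x ^ i * conjLin p y ^ j).natDegree ≤ i + j := by
  have h : ∀ x : K, (conjLin p x).natDegree ≤ 1 := fun x => by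
    unfold conjLin; compute_degree
  refine Polynomial.natDegree_mul_le.trans (add_le_add ?_ ?_) <;>
  · refine Polynomial.natDegree_pow_le.trans ?_
    simpa using Nat.mul_le_mul_left _ (h _)

lemma linearMap_eq_sum (L : Polynomial K →ₗ[K] K) {q : Polynomial K} {n : ℕ}
    (hq : q.natDegree ≤ n) :
    L q = ∑ a ∈ Finset.range (n + 1), q.coeff a * L (Polynomial.X ^ a) := by
  conv_lhs => rw [q.as_sum_range_C_mul_X_pow' (Nat.lt_succ_of_le hq)]
  simp only [map_sum, ← Polynomial.smul_eq_C_mul, map_smul, smul_eq_mul]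

lemma conjLin_add [Fact p.Prime] [CharP K p] (x y : K) :
    conjLin p (x + y) = conjLin p x + conjLin p y := by
  simp only [conjLin, add_pow_char, map_add]
  ring

lemma conjLin_pow_char [Fact p.Prime] [CharP K p] (hK : ∀ x : K, (x ^ p) ^ p = x) (x : K) :
    conjLin p x ^ p = Polynomial.C (x ^ p) * Polynomial.X ^ p - Polynomial.C x := by
  rw [conjLin, sub_pow_char, mul_pow, ← map_pow, ← map_pow, hK]

end ConjLin

section TorusEval

variable {p : ℕ} [Fact p.Prime] {K : Type*} [Field K] [Algebra (ZMod p) K]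

/-- Substitution of `x Z - x^p` for `X`, `Y` and of constants for `S`, `T`, where `x` runs through
the coordinates of `w`. -/
noncomputable def torusEval (E : K →ₐ[ZMod p] K) (w : Fin 2 → K) :
    MvPolynomial (Fin 2 × Fin 2) K →ₐ[K] Polynomial K :=
  aeval fun v => if v.1 = 0 then conjLin p (w v.2) else Polynomial.C (E (w v.2))

/-- The row vector `(1, α) g`. -/
def torusCoord (α : K) (g : Matrix (Fin 2) (Fin 2) (ZMod p)) (j : Fin 2) : K :=
  algebraMap (ZMod p) K (g 0 j) + algebraMap (ZMod p) K (g 1 j) * α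

/-- The map `R ↦ (g ↦ L (R(g)))` from polynomials to functions on `GL₂(𝔽_p)`. -/
noncomputable def anisotropicMap (E : K →ₐ[ZMod p] K) (L : Polynomial K →ₗ[K] K) (α : K) :
    MvPolynomial (Fin 2 × Fin 2) K →ₗ[K] (Matrix.GeneralLinearGroup (Fin 2) (ZMod p) → K) :=
  LinearMap.pi fun g => L ∘ₗ (torusEval E (torusCoord α g.val)).toLinearMap

lemma anisotropicMap_apply (E : K →ₐ[ZMod p] K) (L : Polynomial K →ₗ[K] K) (α : K)
    (R : MvPolynomial (Fin 2 × Fin 2) K) (g : Matrix.GeneralLinearGroup (Fin 2) (ZMod p)) :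
    anisotropicMap E L α R g = L (torusEval E (torusCoord α g.val) R) := rfl

lemma torusEval_biMon (E : K →ₐ[ZMod p] K) (w : Fin 2 → K) (i j d e : ℕ) :
    torusEval E w (biMon K i j d e) =
      conjLin p (w 0) ^ i * conjLin p (w 1) ^ j * Polynomial.C (E (w 0) ^ d * E (w 1) ^ e) := by
  simp [torusEval, biMon, mul_assoc]

lemma conjLin_algebraMap_mul (a : ZMod p) (x : K) :
    conjLin p (algebraMap (ZMod p) K a * x) =
      Polynomial.C (algebraMap (ZMod p) K a) * conjLin p x := by
  simp only [conjLin, mul_pow, ← map_pow, ZMod.pow_card, map_mul]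
  ring

lemma torusCoord_mul (α : K) (g h : Matrix (Fin 2) (Fin 2) (ZMod p)) (j : Fin 2) :
    torusCoord α (g * h) j = algebraMap (ZMod p) K (h 0 j) * torusCoord α g 0 +
      algebraMap (ZMod p) K (h 1 j) * torusCoord α g 1 := by
  simp only [torusCoord, Matrix.mul_apply, Fin.sum_univ_two, map_add, map_mul]
  ring

lemma torusEval_actK [CharP K p] (E : K →ₐ[ZMod p] K) (α : K)
    (g h : Matrix (Fin 2) (Fin 2) (ZMod p)) (R : MvPolynomial (Fin 2 × Fin 2) K) :
    torusEval E (torusCoord α g) (actK p K h R) = torusEval E (torusCoord α (g * h)) R := by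
  have : (torusEval E (torusCoord α g)).comp (aeval fun v : Fin 2 × Fin 2 =>
      C (algebraMap (ZMod p) K (h 0 v.2)) * X (v.1, 0) +
        C (algebraMap (ZMod p) K (h 1 v.2)) * X (v.1, 1)) =
      torusEval E (torusCoord α (g * h)) := by
    refine algHom_ext fun v => ?_
    obtain ⟨a, j⟩ := v
    have hC : ∀ x : K, torusEval E (torusCoord α g) (C x) = Polynomial.C x := fun x =>
      (torusEval E (torusCoord α g)).commutes x
    have hX : ∀ v w, torusEval E w (X v) =
        if v.1 = 0 then conjLin p (w v.2) else Polynomial.C (E (w v.2)) := fun v w => aeval_X _ _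
    simp only [AlgHom.comp_apply, aeval_X, map_add, map_mul, hC, hX, torusCoord_mul]
    split_ifs
    · rw [conjLin_add, conjLin_algebraMap_mul, conjLin_algebraMap_mul]
    · simp
  exact DFunLike.congr_fun this R

lemma torusEval_dickson [CharP K p] (hK : ∀ x : K, (x ^ p) ^ p = x) (E : K →ₐ[ZMod p] K)
    (w : Fin 2 → K) :
    torusEval E w (dickson p K) =
      Polynomial.C (w 0 * w 1 ^ p - w 0 ^ p * w 1) * (Polynomial.X ^ (p + 1) - 1) := by
  have : torusEval E w (dickson p K) =
      conjLin p (w 0) * conjLin p (w 1) ^ p - conjLin p (w 0) ^ p * conjLin p (w 1) := by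
    simp [torusEval, dickson]
  rw [this, conjLin_pow_char hK, conjLin_pow_char hK]
  simp only [conjLin, map_sub, map_mul, pow_succ]
  ring

lemma torusEval_DK_biMon [CharP K p] (hK : ∀ x : K, (x ^ p) ^ p = x) (E : K →ₐ[ZMod p] K)
    (w : Fin 2 → K) (i j d e : ℕ) :
    torusEval E w (DK p K (biMon K i j d e)) = (E (w 0) ^ d * E (w 1) ^ e) •
      (Polynomial.X ^ (p + 1) *
          Polynomial.derivative (conjLin p (w 0) ^ i * conjLin p (w 1) ^ j) -
        ((i + j : ℕ) : K) • (Polynomial.X ^ p * (conjLin p (w 0) ^ i * conjLin p (w 1) ^ j)) -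
        Polynomial.derivative (conjLin p (w 0) ^ i * conjLin p (w 1) ^ j)) := by
  have hd : ∀ x : K, Polynomial.derivative (conjLin p x) = Polynomial.C x := fun x => by
    rw [conjLin, Polynomial.derivative_sub, Polynomial.derivative_C_mul, Polynomial.derivative_X,
      Polynomial.derivative_C, mul_one, sub_zero]
  have hs : ∀ (x : K) (i : ℕ),
      (i : Polynomial K) * conjLin p x ^ (i - 1) * conjLin p x = i * conjLin p x ^ i := by
    rintro x (_ | i)
    · simp
    · rw [Nat.add_sub_cancel, pow_succ]; ring
  rw [DK_biMon, map_add, map_smul, map_smul, torusEval_biMon, torusEval_biMon,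
    Polynomial.derivative_mul, Polynomial.derivative_pow, Polynomial.derivative_pow, hd, hd,
    pow_add, pow_add, conjLin_pow_char hK, conjLin_pow_char hK]
  simp only [Polynomial.smul_eq_C_mul, map_natCast, map_add, Nat.cast_add]
  have h₀ := hs (w 0) i
  have h₁ := hs (w 1) j
  set A := conjLin p (w 0) ^ i
  set B := conjLin p (w 1) ^ j
  have e₀ : Polynomial.C (w 0 ^ p) = Polynomial.C (w 0) * Polynomial.X - conjLin p (w 0) := by
    rw [conjLin]; ring
  have e₁ : Polynomial.C (w 1 ^ p) = Polynomial.C (w 1) * Polynomial.X - conjLin p (w 1) := by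
    rw [conjLin]; ring
  rw [e₀, e₁]
  linear_combination (-Polynomial.X ^ p * Polynomial.C (E (w 0) ^ d * E (w 1) ^ e)) *
    (B * h₀ + A * h₁)

lemma torusEval_DK_eq_zero [CharP K p] (hK : ∀ x : K, (x ^ p) ^ p = x) (E : K →ₐ[ZMod p] K)
    (w : Fin 2 → K) (L : Polynomial K →ₗ[K] K) {m n : ℕ}
    (hL : ∀ a ≤ m, ((a : K) - m) * L (Polynomial.X ^ (p + a)) = a * L (Polynomial.X ^ (a - 1)))
    {S : MvPolynomial (Fin 2 × Fin 2) K} (hS : S ∈ biHom K m n) :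
    L (torusEval E w (DK p K S)) = 0 := by
  let Λ : Polynomial K →ₗ[K] K :=
    L ∘ₗ (LinearMap.mulLeft K (Polynomial.X ^ (p + 1)) ∘ₗ Polynomial.derivative -
      (m : K) • LinearMap.mulLeft K (Polynomial.X ^ p) - Polynomial.derivative)
  have hΛ : ∀ q : Polynomial K, q.natDegree ≤ m → Λ q = 0 := by
    intro q hq
    rw [linearMap_eq_sum Λ hq]
    refine Finset.sum_eq_zero fun a ha => mul_eq_zero_of_right _ ?_
    have h := hL a (Finset.mem_range_succ_iff.1 ha)
    have hX : (a : K) * L (Polynomial.X ^ (p + 1 + (a - 1))) =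
        a * L (Polynomial.X ^ (p + a)) := by
      rcases a with _ | a
      · simp
      · rw [Nat.add_sub_cancel, add_assoc, add_comm 1 a]
    simp only [Λ, LinearMap.comp_apply, LinearMap.sub_apply, LinearMap.smul_apply,
      LinearMap.mulLeft_apply, Polynomial.derivative_X_pow, ← Polynomial.smul_eq_C_mul,
      ← pow_add, map_sub, map_smul, smul_eq_mul]
    linear_combination h + hX
  induction hS using Submodule.span_induction with
  | mem S hS =>
    obtain ⟨i, j, d, e, rfl, rfl, rfl⟩ := hS
    rw [torusEval_DK_biMon hK, map_smul]
    have := hΛ _ (natDegree_conjLin_mul_le (p := p) (w 0) (w 1) i j)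
    simp only [Λ, LinearMap.comp_apply, LinearMap.sub_apply, LinearMap.smul_apply,
      LinearMap.mulLeft_apply] at this
    rw [this, smul_zero]
  | zero => simp
  | add P Q _ _ hP hQ => rw [map_add, map_add, map_add, hP, hQ, add_zero]
  | smul a P _ hP => rw [map_smul, map_smul, map_smul, hP, smul_zero]

lemma torusEval_smul (E : K →ₐ[ZMod p] K) (w : Fin 2 → K) (L : Polynomial K →ₗ[K] K) {c μ : K}
    (hc : c ≠ 0) {n₁ n₂ : ℕ}
    (hL : ∀ a ≤ n₁, L (Polynomial.X ^ a) ≠ 0 → c ^ a * (c ^ p) ^ (n₁ - a) * E c ^ n₂ = μ)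
    {R : MvPolynomial (Fin 2 × Fin 2) K} (hR : R ∈ biHom K n₁ n₂) :
    L (torusEval E (c • w) R) = μ * L (torusEval E w R) := by
  induction hR using Submodule.span_induction with
  | mem R hR =>
    obtain ⟨i, j, d, e, rfl, rfl, rfl⟩ := hR
    have hlin : ∀ x : K, conjLin p (c * x) = Polynomial.C (c ^ p) *
        (conjLin p x).comp (Polynomial.C (c * (c ^ p)⁻¹) * Polynomial.X) := by
      intro x
      have : c ^ p ≠ 0 := pow_ne_zero _ hc
      simp only [conjLin, Polynomial.sub_comp, Polynomial.mul_comp, Polynomial.C_comp,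
        Polynomial.X_comp, mul_sub, ← mul_assoc, ← map_mul, mul_pow]
      congr 3
      field_simp
    set q := conjLin p (w 0) ^ i * conjLin p (w 1) ^ j with hq
    have hq' : conjLin p (c * w 0) ^ i * conjLin p (c * w 1) ^ j =
        Polynomial.C ((c ^ p) ^ (i + j)) *
          q.comp (Polynomial.C (c * (c ^ p)⁻¹) * Polynomial.X) := by
      rw [hlin, hlin, hq, Polynomial.mul_comp, Polynomial.pow_comp, Polynomial.pow_comp,
        map_pow Polynomial.C (c ^ p) (i + j)]
      generalize Polynomial.C (c ^ p) = y
      ring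
    have hdeg := natDegree_conjLin_mul_le (p := p) (w 0) (w 1) i j
    have hdeg' := natDegree_conjLin_mul_le (p := p) (c * w 0) (c * w 1) i j
    rw [torusEval_biMon, torusEval_biMon, mul_comm _ (Polynomial.C _), mul_comm _ (Polynomial.C _),
      ← Polynomial.smul_eq_C_mul, ← Polynomial.smul_eq_C_mul, map_smul, map_smul]
    simp only [Pi.smul_apply, smul_eq_mul, map_mul]
    rw [linearMap_eq_sum L hdeg, linearMap_eq_sum L hdeg', Finset.mul_sum, Finset.mul_sum,
      Finset.mul_sum, hq', ← hq]
    refine Finset.sum_congr rfl fun a ha => ?_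
    rw [Polynomial.coeff_C_mul, Polynomial.comp_C_mul_X_coeff]
    by_cases h0 : L (Polynomial.X ^ a) = 0
    · simp [h0]
    have ha' := Finset.mem_range_succ_iff.1 ha
    rw [← hL a ha' h0, ← Nat.sub_add_cancel ha', pow_add _ (i + j - a) a, Nat.sub_add_cancel ha',
      mul_pow c, inv_pow]
    have : (c ^ p) ^ a ≠ 0 := pow_ne_zero _ (pow_ne_zero _ hc)
    field_simp
    ring
  | zero => simp
  | add P Q _ _ hP hQ => rw [map_add, map_add, map_add, map_add, hP, hQ, mul_add]
  | smul a P _ hP =>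
    rw [map_smul, map_smul, map_smul, map_smul, hP, smul_eq_mul, smul_eq_mul, mul_left_comm]

end TorusEval

section Interpolation

variable {p : ℕ} [Fact p.Prime] {K : Type*} [Field K] [Algebra (ZMod p) K]

lemma eq_zero_of_sum_smul_eq_zero {ι : Type*} [Fintype ι] {f : ι → Polynomial K}
    (hf : ∀ i, f i ≠ 0) (hinj : Function.Injective fun i => (f i).natDegree) {c : ι → K}
    (h : ∑ i, c i • f i = 0) : c = 0 := by
  classical
  by_contra hc
  obtain ⟨i₀, hi₀⟩ := Function.ne_iff.1 hc
  obtain ⟨i, hi, hmax⟩ := Finset.exists_max_image (Finset.univ.filter fun i => c i ≠ 0)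
    (fun i => (f i).natDegree) ⟨i₀, by simpa using hi₀⟩
  have hcoeff := congrArg (fun q => Polynomial.coeff q (f i).natDegree) h
  simp only [Polynomial.finsetSum_coeff, Polynomial.coeff_smul, smul_eq_mul,
    Polynomial.coeff_zero] at hcoeff
  rw [Finset.sum_eq_single i] at hcoeff
  · exact (mul_ne_zero (by simpa using hi) (Polynomial.leadingCoeff_ne_zero.2 (hf i))) hcoeff
  · intro j _ hj
    by_cases hcj : c j = 0
    · rw [hcj, zero_mul]
    · rw [Polynomial.coeff_eq_zero_of_natDegree_lt, mul_zero]
      exact lt_of_le_of_ne (hmax j (by simpa using hcj)) fun h => hj (hinj h)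
  · exact fun h => (h (Finset.mem_univ i)).elim

lemma ne_zero_of_add_mul_eq_zero {α : K} (hα : α ∉ Set.range (algebraMap (ZMod p) K))
    {a b : ZMod p} (h : algebraMap (ZMod p) K a + algebraMap (ZMod p) K b * α = 0) :
    a = 0 ∧ b = 0 := by
  have hb : b = 0 := by
    by_contra hb
    refine hα ⟨-a / b, ?_⟩
    have hb' : algebraMap (ZMod p) K b ≠ 0 := by simpa using hb
    rw [map_div₀, map_neg, div_eq_iff hb']
    linear_combination -h
  subst hb
  simpa using h

lemma exists_eq_add_mul [Fintype K] (hK : Fintype.card K = p ^ 2) {α : K}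
    (hα : α ∉ Set.range (algebraMap (ZMod p) K)) (x : K) :
    ∃ a b : ZMod p, algebraMap (ZMod p) K a + algebraMap (ZMod p) K b * α = x := by
  have h : Function.Bijective fun c : ZMod p × ZMod p =>
      algebraMap (ZMod p) K c.1 + algebraMap (ZMod p) K c.2 * α := by
    refine (Fintype.bijective_iff_injective_and_card _).2 ⟨fun c d hcd => ?_, ?_⟩
    · have := ne_zero_of_add_mul_eq_zero hα (a := c.1 - d.1) (b := c.2 - d.2) (by
        simp only [map_sub]
        linear_combination hcd)
      exact Prod.ext (sub_eq_zero.1 this.1) (sub_eq_zero.1 this.2)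
    · rw [Fintype.card_prod, ZMod.card, hK, sq]
  obtain ⟨c, hc⟩ := h.2 x
  exact ⟨c.1, c.2, hc⟩

/-- The matrices `[[a, 1], [c, 0]]` with `c ≠ 0`, which represent the right cosets of the
anisotropic torus. -/
noncomputable def torusRep (q : ZMod p × (ZMod p)ˣ) :
    Matrix.GeneralLinearGroup (Fin 2) (ZMod p) :=
  Matrix.GeneralLinearGroup.mkOfDetNeZero !![q.1, 1; (q.2 : ZMod p), 0] (by simp)

lemma torusCoord_torusRep (α : K) (q : ZMod p × (ZMod p)ˣ) :
    torusCoord α (torusRep q).val 0 =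
        algebraMap (ZMod p) K q.1 + algebraMap (ZMod p) K q.2 * α ∧
      torusCoord α (torusRep q).val 1 = 1 := by
  simp [torusCoord, torusRep, Matrix.GeneralLinearGroup.mkOfDetNeZero]

variable [CharP K p] (E : K →ₐ[ZMod p] K) (L : Polynomial K →ₗ[K] K)

lemma apply_torusEval_cuspRep (hK : ∀ x : K, (x ^ p) ^ p = x) {k m : ℕ}
    {F : Fin (p - 1) → Polynomial K}
    (hF : ∀ i x, L ((Polynomial.X ^ (p + 1) - 1) ^ k * (conjLin p x ^ (i.1 + 1) *
      (Polynomial.X - 1) ^ (m + (p - 1) - (i.1 + 1)))) = (F i).eval (E x))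
    {w : Fin 2 → K} (hw : w 1 = 1) (q : Fin (p - 1) × Fin p) :
    L (torusEval E w (cuspRep p K k m q)) =
      (w 0 - w 0 ^ p) ^ k * (F q.1 * Polynomial.X ^ (q.2 : ℕ)).eval (E (w 0)) := by
  have h1 : conjLin p (1 : K) = Polynomial.X - 1 := by simp [conjLin]
  rw [cuspRep, map_mul, map_pow, torusEval_dickson hK, torusEval_biMon, hw, h1,
    Polynomial.eval_mul, Polynomial.eval_pow, Polynomial.eval_X, ← hF, mul_pow, ← map_pow]
  simp only [map_one, one_pow, mul_one]
  rw [mul_comm _ (Polynomial.C (E _ ^ _)), ← Polynomial.smul_eq_C_mul, ← Polynomial.smul_eq_C_mul,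
    smul_mul_smul_comm, map_smul, smul_eq_mul]
  ring

lemma eq_zero_of_apply_torusRep [Fintype K] (hK : Fintype.card K = p ^ 2) {α : K}
    (hα : α ∉ Set.range (algebraMap (ZMod p) K)) {k m : ℕ} {F : Fin (p - 1) → Polynomial K}
    (hdeg : ∀ i, (F i).natDegree = p * (i + 1))
    (hF : ∀ i x, L ((Polynomial.X ^ (p + 1) - 1) ^ k * (conjLin p x ^ (i.1 + 1) *
      (Polynomial.X - 1) ^ (m + (p - 1) - (i.1 + 1)))) = (F i).eval (E x))
    (hF₀ : ∀ i a, (F i).eval (algebraMap (ZMod p) K a) = 0)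
    {c : Fin (p - 1) × Fin p → K}
    (hc : ∀ q, anisotropicMap E L α (∑ i, c i • cuspRep p K k m i) (torusRep q) = 0) : c = 0 := by
  have hp : 0 < p := (Fact.out : p.Prime).pos
  have hKp : ∀ x : K, (x ^ p) ^ p = x := fun x => by
    rw [← pow_mul, ← sq, ← hK, FiniteField.pow_card]
  have hnd : ∀ q : Fin (p - 1) × Fin p,
      (F q.1 * Polynomial.X ^ (q.2 : ℕ)).natDegree = p * (q.1 + 1) + q.2 := fun q => by
    have h0 : F q.1 ≠ 0 := fun h => by
      have := hdeg q.1
      rw [h, Polynomial.natDegree_zero] at this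
      exact (mul_pos hp (Nat.succ_pos _)).ne this
    rw [Polynomial.natDegree_mul h0 (pow_ne_zero _ Polynomial.X_ne_zero), hdeg,
      Polynomial.natDegree_X_pow]
  refine eq_zero_of_sum_smul_eq_zero (f := fun q => F q.1 * Polynomial.X ^ (q.2 : ℕ))
    (fun q h => ?_) (fun q q' h => ?_) ?_
  · have := hnd q
    rw [h, Polynomial.natDegree_zero] at this
    have : 0 < p * (q.1.1 + 1) := mul_pos hp (Nat.succ_pos _)
    omega
  · simp only [hnd] at h
    have h2 : q.2.1 = q'.2.1 := by
      simpa [Nat.mul_add_mod, Nat.mod_eq_of_lt q.2.2, Nat.mod_eq_of_lt q'.2.2] using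
        congrArg (· % p) h
    have h1 : q.1.1 + 1 = q'.1.1 + 1 := Nat.eq_of_mul_eq_mul_left hp (by omega)
    exact Prod.ext (Fin.ext (by omega)) (Fin.ext h2)
  · refine Polynomial.eq_zero_of_natDegree_lt_card_of_eval_eq_zero _
      (Finite.injective_iff_bijective.1 E.injective).1 (fun x => ?_) ?_
    · rw [Polynomial.eval_finsetSum]
      simp only [Polynomial.eval_smul]
      obtain ⟨a, b, rfl⟩ := exists_eq_add_mul hK hα x
      by_cases hb : b = 0
      · subst hb
        refine Finset.sum_eq_zero fun q _ => ?_
        simp [hF₀]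
      · have h := hc (a, Units.mk0 b hb)
        obtain ⟨h0, h1⟩ := torusCoord_torusRep α (a, Units.mk0 b hb)
        simp only [map_sum, map_smul, anisotropicMap_apply,
          apply_torusEval_cuspRep E L hKp hF h1, h0, Units.val_mk0] at h
        set x := algebraMap (ZMod p) K a + algebraMap (ZMod p) K b * α with hx
        have hx0 : x - x ^ p ≠ 0 := by
          intro h
          obtain ⟨n, hn⟩ := (mem_bot_iff_intCast p K).1
            ((Subfield.mem_bot_iff_pow_eq_self K p).2 (sub_eq_zero.1 h).symm)
          refine hb (ne_zero_of_add_mul_eq_zero hα (a := a - n) ?_).2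
          rw [map_sub, map_intCast, hn, hx]
          ring
        simp only [smul_eq_mul, mul_left_comm (c _), ← Finset.mul_sum] at h ⊢
        exact (mul_eq_zero.1 h).resolve_left (pow_ne_zero _ hx0)
    · refine lt_of_le_of_lt
        (Polynomial.natDegree_sum_le_of_forall_le (n := p * p - 1) _ _ fun q _ => ?_) ?_
      · refine (Polynomial.natDegree_smul_le _ _).trans ?_
        rw [hnd]
        have : p * (q.1.1 + 1) ≤ p * (p - 1) := Nat.mul_le_mul_left _ q.1.2
        have h2 := q.2.2
        rw [Nat.mul_sub_one] at this
        have : p ≤ p * p := Nat.le_mul_self p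
        omega
      · rw [hK, sq]
        have := mul_pos hp hp
        omega

end Interpolation

section Core

variable {p : ℕ} [Fact p.Prime] {K : Type*} [Field K] [Algebra (ZMod p) K]

lemma torusCoord_torus_mul {α : K} {β : ZMod p} (hα : α ^ 2 = algebraMap (ZMod p) K β)
    (u v : ZMod p) (g : Matrix (Fin 2) (Fin 2) (ZMod p)) :
    torusCoord α (!![u, v * β; v, u] * g) =
      (algebraMap (ZMod p) K u + algebraMap (ZMod p) K v * α) • torusCoord α g := by
  funext j
  simp only [torusCoord, Matrix.mul_apply, Fin.sum_univ_two, Pi.smul_apply, smul_eq_mul,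
    Matrix.of_apply, Matrix.cons_val', Matrix.cons_val_zero, Matrix.cons_val_one,
    Matrix.cons_val_fin_one, map_add, map_mul, ← hα]
  ring

lemma exists_torus_mul_torusRep {α : K} {β : ZMod p} (hα : α ^ 2 = algebraMap (ZMod p) K β)
    (hα' : α ∉ Set.range (algebraMap (ZMod p) K))
    (g : Matrix.GeneralLinearGroup (Fin 2) (ZMod p)) :
    ∃ (t : Matrix.GeneralLinearGroup (Fin 2) (ZMod p)) (u v : ZMod p) (q : ZMod p × (ZMod p)ˣ),
      t.val = !![u, v * β; v, u] ∧ g = t * torusRep q := by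
  have hg : g.val 0 0 * g.val 1 1 - g.val 0 1 * g.val 1 0 ≠ 0 := by
    rw [← Matrix.det_fin_two]
    exact g.det.ne_zero
  set a := g.val 0 0 with ha
  set b := g.val 0 1 with hb
  set c := g.val 1 0 with hc
  set d := g.val 1 1 with hd
  have hN : b ^ 2 - d ^ 2 * β ≠ 0 := by
    intro h
    have h' : (algebraMap (ZMod p) K b + algebraMap (ZMod p) K d * α) *
        (algebraMap (ZMod p) K b + algebraMap (ZMod p) K (-d) * α) = 0 := by
      have := congrArg (algebraMap (ZMod p) K) h
      simp only [map_sub, map_mul, map_pow, map_zero, map_neg, ← hα] at this ⊢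
      linear_combination this
    have hbd : b = 0 ∧ d = 0 := by
      rcases mul_eq_zero.1 h' with h | h
      · exact ne_zero_of_add_mul_eq_zero hα' h
      · simpa using ne_zero_of_add_mul_eq_zero hα' h
    rw [hbd.1, hbd.2] at hg
    simp at hg
  have hq : (b * c - a * d) / (b ^ 2 - d ^ 2 * β) ≠ 0 :=
    div_ne_zero (fun h => hg (by linear_combination -h)) hN
  refine ⟨Matrix.GeneralLinearGroup.mkOfDetNeZero !![b, d * β; d, b]
    (by rw [Matrix.det_fin_two_of]; exact fun h => hN (by linear_combination h)), b, d,
    ((a * b - c * d * β) / (b ^ 2 - d ^ 2 * β), Units.mk0 _ hq), rfl, ?_⟩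
  refine Units.ext (Matrix.ext fun i j => ?_)
  fin_cases i <;> fin_cases j <;>
    simp [torusRep, Matrix.GeneralLinearGroup.mkOfDetNeZero, Matrix.mul_apply, Fin.sum_univ_two,
      ← ha, ← hb, ← hc, ← hd]
  all_goals
    field_simp
    ring

/-- Criterion for the map attached to `E` and `L` to induce the isomorphism of
`cuspidal_twist_iso`. -/
lemma exists_iso_of_functional [Fintype K] [CharP K p] (hK : Fintype.card K = p ^ 2)
    {α : K} {β : ZMod p}
    (hα : α ^ 2 = algebraMap (ZMod p) K β) (hα' : α ∉ Set.range (algebraMap (ZMod p) K))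
    {k m : ℕ} (hm : 1 ≤ m) (hmk : m + k ≤ p - 1)
    (E : K →ₐ[ZMod p] K) (L : Polynomial K →ₗ[K] K) (F : Fin (p - 1) → Polynomial K)
    (hT : ∀ a ≤ m + (p - 1) + k * (p + 1), ∀ x : K, x ≠ 0 → L (Polynomial.X ^ a) ≠ 0 →
      x ^ a * (x ^ p) ^ (m + (p - 1) + k * (p + 1) - a) * E x ^ (p - 1) = x ^ (m + k * (p + 1)))
    (hD : ∀ a ≤ m + k * (p + 1), ((a : K) - (m + k * (p + 1) : ℕ)) * L (Polynomial.X ^ (p + a)) =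
      a * L (Polynomial.X ^ (a - 1)))
    (hdeg : ∀ i, (F i).natDegree = p * (i + 1))
    (hF : ∀ i x, L ((Polynomial.X ^ (p + 1) - 1) ^ k * (conjLin p x ^ (i.1 + 1) *
      (Polynomial.X - 1) ^ (m + (p - 1) - (i.1 + 1)))) = (F i).eval (E x))
    (hL : L ((Polynomial.X ^ (p + 1) - 1) ^ k * (Polynomial.X - 1) ^ (m + (p - 1))) = 0) :
    ∃ ψ : MvPolynomial (Fin 2 × Fin 2) K →ₗ[K]
        (Matrix.GeneralLinearGroup (Fin 2) (ZMod p) → K),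
      (∀ R, IsBiHom (m + (p - 1) + k * (p + 1)) (p - 1) R →
        ∀ (t g : Matrix.GeneralLinearGroup (Fin 2) (ZMod p)) (u v : ZMod p),
          t.val = !![u, v * β; v, u] →
          ψ R (t * g) = (algebraMap (ZMod p) K u + algebraMap (ZMod p) K v * α) ^
            (m + k * (p + 1)) * ψ R g) ∧
      (∀ (g : Matrix.GeneralLinearGroup (Fin 2) (ZMod p)) (R : MvPolynomial (Fin 2 × Fin 2) K),
        IsBiHom (m + (p - 1) + k * (p + 1)) (p - 1) R →
          ψ (actK p K g.val R) = fun x => ψ R (x * g)) ∧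
      (∀ R, IsBiHom (m + (p - 1) + k * (p + 1)) (p - 1) R →
        (ψ R = 0 ↔ ∃ S, IsBiHom (m + k * (p + 1)) (p - 1) S ∧ DK p K S = R)) ∧
      (∀ h : Matrix.GeneralLinearGroup (Fin 2) (ZMod p) → K,
        (∀ (t g : Matrix.GeneralLinearGroup (Fin 2) (ZMod p)) (u v : ZMod p),
          t.val = !![u, v * β; v, u] →
          h (t * g) = (algebraMap (ZMod p) K u + algebraMap (ZMod p) K v * α) ^
            (m + k * (p + 1)) * h g) →
        ∃ R, IsBiHom (m + (p - 1) + k * (p + 1)) (p - 1) R ∧ ψ R = h) := by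
  simp only [isBiHom_iff_mem]
  have hKp : ∀ x : K, (x ^ p) ^ p = x := fun x => by
    rw [← pow_mul, ← sq, ← hK, FiniteField.pow_card]
  have hF₀ : ∀ i (a : ZMod p), (F i).eval (algebraMap (ZMod p) K a) = 0 := by
    intro i a
    have hi := i.2
    have h1 : conjLin p (algebraMap (ZMod p) K a) =
        Polynomial.C (algebraMap (ZMod p) K a) * (Polynomial.X - 1) := by
      simpa [conjLin] using conjLin_algebraMap_mul (K := K) a 1
    have h := hF i (algebraMap (ZMod p) K a)
    rw [h1, mul_pow, mul_assoc, ← pow_add, Nat.add_sub_cancel' (by omega), ← map_pow,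
      ← Polynomial.smul_eq_C_mul, mul_smul_comm, map_smul, hL, smul_zero, AlgHom.commutes] at h
    exact h.symm
  have hequiv : ∀ R ∈ biHom K (m + (p - 1) + k * (p + 1)) (p - 1),
      ∀ (t g : Matrix.GeneralLinearGroup (Fin 2) (ZMod p)) (u v : ZMod p),
        t.val = !![u, v * β; v, u] →
        anisotropicMap E L α R (t * g) =
          (algebraMap (ZMod p) K u + algebraMap (ZMod p) K v * α) ^
            (m + k * (p + 1)) * anisotropicMap E L α R g := by
    intro R hR t g u v ht
    have hx : algebraMap (ZMod p) K u + algebraMap (ZMod p) K v * α ≠ 0 := by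
      intro h
      obtain ⟨rfl, rfl⟩ := ne_zero_of_add_mul_eq_zero hα' h
      have := t.det.ne_zero
      rw [Matrix.GeneralLinearGroup.val_det_apply, ht, Matrix.det_fin_two_of] at this
      simp at this
    rw [anisotropicMap_apply, anisotropicMap_apply, Units.val_mul, ht, torusCoord_torus_mul hα]
    exact torusEval_smul E _ L hx (fun a ha => hT a ha _ hx) hR
  have hDK : ∀ S ∈ biHom K (m + k * (p + 1)) (p - 1), anisotropicMap E L α (DK p K S) = 0 :=
    fun S hS => funext fun g => torusEval_DK_eq_zero hKp E _ L hD hS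
  refine ⟨anisotropicMap E L α, hequiv, fun g R _ => funext fun x => ?_,
    fun R hR => ⟨fun h => ?_, ?_⟩, fun h hh => ?_⟩
  · rw [anisotropicMap_apply, torusEval_actK]
    rfl
  · obtain ⟨c, S, hS, rfl⟩ := exists_cuspRep_add_DK p hm hmk hR
    rw [map_add, hDK S hS, add_zero] at h
    have hc := eq_zero_of_apply_torusRep E L hK hα' hdeg hF hF₀ fun q => congrFun h _
    exact ⟨S, hS, by simp [hc]⟩
  · rintro ⟨S, hS, rfl⟩
    exact hDK S hS
  · let M : (Fin (p - 1) × Fin p → K) →ₗ[K] (ZMod p × (ZMod p)ˣ → K) :=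
      LinearMap.funLeft K K torusRep ∘ₗ anisotropicMap E L α ∘ₗ
        Fintype.linearCombination K (cuspRep p K k m)
    have hM : Function.Surjective M := by
      refine (LinearMap.injective_iff_surjective_of_finrank_eq_finrank ?_).1 ?_
      · simp [Nat.totient_prime (Fact.out : p.Prime), mul_comm]
      · refine (injective_iff_map_eq_zero M).2 fun c hc => ?_
        exact eq_zero_of_apply_torusRep E L hK hα' hdeg hF hF₀ fun q => congrFun hc q
    obtain ⟨c, hc⟩ := hM (h ∘ torusRep)
    have hR : ∑ i, c i • cuspRep p K k m i ∈ biHom K (m + (p - 1) + k * (p + 1)) (p - 1) :=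
      Submodule.sum_mem _ fun i _ => Submodule.smul_mem _ _ (cuspRep_mem p hm i)
    refine ⟨_, hR, funext fun g => ?_⟩
    obtain ⟨t, u, v, q, ht, rfl⟩ := exists_torus_mul_torusRep hα hα' g
    rw [hequiv _ hR t _ u v ht, hh t _ u v ht]
    exact congrArg _ (congrFun hc q)

end Core

section Functionals

variable {p : ℕ} {K : Type*} [Field K]

lemma natCast_ne_zero_of_lt_char [CharP K p] {a : ℕ} (h₀ : 0 < a) (h : a < p) : (a : K) ≠ 0 :=
  fun h' => (Nat.le_of_dvd h₀ ((CharP.cast_eq_zero_iff K p a).1 h')).not_gt h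

variable [Fact p.Prime]

lemma exists_eval_eq_apply_conjLin [Algebra (ZMod p) K] (L : Polynomial K →ₗ[K] K)
    (E : K →ₐ[ZMod p] K) {i j s₀ : ℕ} (e : ℕ → ℕ)
    (he : ∀ x : K, ∀ s ≤ i, x ^ s * (x ^ p) ^ (i - s) = E x ^ e s) (hs₀ : s₀ ≤ i)
    (hlt : ∀ s ≤ i, s ≠ s₀ → e s < e s₀) (hi : i.choose s₀ = 1)
    (hL : L (Polynomial.X ^ s₀ * (Polynomial.X - 1) ^ j) ≠ 0) :
    ∃ F : Polynomial K, F.natDegree = e s₀ ∧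
      ∀ x, L (conjLin p x ^ i * (Polynomial.X - 1) ^ j) = F.eval (E x) := by
  set a : ℕ → K := fun s => (-1) ^ (i - s) * (i.choose s : K) *
    L (Polynomial.X ^ s * (Polynomial.X - 1) ^ j) with ha
  refine ⟨∑ s ∈ Finset.range (i + 1), Polynomial.C (a s) * Polynomial.X ^ e s, ?_, fun x => ?_⟩
  · have hmem := Finset.mem_range_succ_iff.2 hs₀
    refine Polynomial.natDegree_eq_of_le_of_coeff_ne_zero
      (Polynomial.natDegree_sum_le_of_forall_le _ _ fun s hs => ?_) ?_
    · refine (Polynomial.natDegree_C_mul_X_pow_le _ _).trans ?_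
      by_cases h : s = s₀
      · rw [h]
      · exact (hlt s (Finset.mem_range_succ_iff.1 hs) h).le
    · rw [Polynomial.finsetSum_coeff, Finset.sum_eq_single_of_mem s₀ hmem]
      · rw [Polynomial.coeff_C_mul_X_pow, if_pos rfl, ha]
        simpa [hi] using hL
      · intro s hs h
        rw [Polynomial.coeff_C_mul_X_pow,
          if_neg (hlt s (Finset.mem_range_succ_iff.1 hs) h).ne']
  · rw [conjLin, sub_eq_add_neg, add_pow, Finset.sum_mul, map_sum, Polynomial.eval_finsetSum]
    refine Finset.sum_congr rfl fun s hs => ?_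
    have : (Polynomial.C x * Polynomial.X) ^ s * (-Polynomial.C (x ^ p)) ^ (i - s) *
        (i.choose s : Polynomial K) * (Polynomial.X - 1) ^ j =
        (x ^ s * (-(x ^ p)) ^ (i - s) * (i.choose s : K)) •
          (Polynomial.X ^ s * (Polynomial.X - 1) ^ j) := by
      simp only [Polynomial.smul_eq_C_mul, map_mul, map_pow, map_neg, map_natCast]
      ring
    rw [this, map_smul, smul_eq_mul, neg_pow, Polynomial.eval_mul, Polynomial.eval_C,
      Polynomial.eval_pow, Polynomial.eval_X, ← he x s (Finset.mem_range_succ_iff.1 hs), ha]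
    ring

lemma natDegree_X_pow_sub_one_pow_mul_le {N k n : ℕ} {q : Polynomial K} (hq : q.natDegree ≤ n) :
    ((Polynomial.X ^ N - 1) ^ k * q).natDegree ≤ n + k * N := by
  refine Polynomial.natDegree_mul_le.trans ?_
  rw [add_comm]
  refine add_le_add hq (Polynomial.natDegree_pow_le.trans (Nat.mul_le_mul_left _ ?_))
  exact Polynomial.natDegree_X_pow_sub_C (R := K) (n := N) (r := 1) |>.le

lemma coeff_X_pow_sub_one_pow_mul {N n : ℕ} {q : Polynomial K} (hq : q.natDegree < n + N) (k : ℕ) :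
    ((Polynomial.X ^ N - 1) ^ k * q).coeff (n + k * N) = q.coeff n := by
  induction k with
  | zero => simp
  | succ k ih =>
    have hN : n + (k + 1) * N = n + k * N + N := by ring
    have := natDegree_X_pow_sub_one_pow_mul_le (N := N) (k := k) (n := n + N - 1) (q := q)
      (by omega)
    rw [pow_succ', mul_assoc, sub_mul, one_mul, Polynomial.coeff_sub, hN, Polynomial.coeff_X_pow_mul,
      ih, Polynomial.coeff_eq_zero_of_natDegree_lt (n := n + k * N + N) (by omega), sub_zero]

lemma coeff_X_sub_one_pow_char_add [CharP K p] {s : ℕ} (hs : s < p) :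
    ((Polynomial.X - 1 : Polynomial K) ^ (p + s + 1)).coeff s = s + 1 := by
  rw [add_assoc, pow_add, sub_pow_char, one_pow, sub_mul, one_mul, Polynomial.coeff_sub,
    Polynomial.coeff_X_pow_mul', if_neg (not_le.2 hs), sub_eq_add_neg Polynomial.X,
    ← Polynomial.C_1, ← Polynomial.C_neg, Polynomial.coeff_X_add_C_pow]
  simp

/-- The functional on polynomials used for `ind_T^G ω₂^{r+2+k(p+1)}`, `r ≥ 0`. -/
noncomputable def dicksonFunctional (K : Type*) [Field K] (N r k : ℕ) : Polynomial K →ₗ[K] K :=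
  ∑ j ∈ Finset.range (k + 2), ((-1) ^ j * ((r + j).factorial * (k + 1 - j).factorial : ℕ) : K) •
    Polynomial.lcoeff K (r + j * N)

lemma dicksonFunctional_apply (N r k : ℕ) (q : Polynomial K) :
    dicksonFunctional K N r k q = ∑ j ∈ Finset.range (k + 2),
      ((-1) ^ j * ((r + j).factorial * (k + 1 - j).factorial : ℕ) : K) * q.coeff (r + j * N) := by
  simp [dicksonFunctional, LinearMap.sum_apply]

lemma dicksonFunctional_X_pow {N r k j : ℕ} (hN : 0 < N) (hj : j ≤ k + 1) :
    dicksonFunctional K N r k (Polynomial.X ^ (r + j * N)) =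
      (-1) ^ j * ((r + j).factorial * (k + 1 - j).factorial : ℕ) := by
  rw [dicksonFunctional_apply, Finset.sum_eq_single_of_mem j (by simpa using by omega)]
  · simp
  · intro b _ hb
    rw [Polynomial.coeff_X_pow, if_neg, mul_zero]
    exact fun h => hb (Nat.eq_of_mul_eq_mul_right hN (by omega))

lemma dicksonFunctional_X_pow_eq_zero {N r k a : ℕ} (h : ∀ j ≤ k + 1, a ≠ r + j * N) :
    dicksonFunctional K N r k (Polynomial.X ^ a) = 0 := by
  rw [dicksonFunctional_apply]
  refine Finset.sum_eq_zero fun j hj => ?_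
  rw [Polynomial.coeff_X_pow, if_neg, mul_zero]
  exact fun h' => h j (by simpa [Nat.lt_succ_iff] using hj) h'.symm

lemma dicksonFunctional_mul {N r k : ℕ} (hr : r < N) {q : Polynomial K}
    (hq : q.natDegree ≤ r + (k + 1) * N) :
    dicksonFunctional K N r (k + 1) ((Polynomial.X ^ N - 1) * q) =
      -((r + k + 3 : ℕ) : K) * dicksonFunctional K N r k q := by
  simp only [dicksonFunctional_apply, sub_mul, one_mul, Polynomial.coeff_sub, mul_sub,
    Finset.sum_sub_distrib]
  rw [Finset.sum_range_succ', Finset.sum_range_succ (n := k + 1 + 1),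
    Polynomial.coeff_eq_zero_of_natDegree_lt (p := q) (n := r + (k + 1 + 1) * N) (by
      rw [add_mul _ 1]; omega), Polynomial.coeff_X_pow_mul', if_neg (by omega), mul_zero, mul_zero,
    add_zero, add_zero, ← Finset.sum_sub_distrib, Finset.mul_sum]
  refine Finset.sum_congr rfl fun j hj => ?_
  have hj' : j ≤ k + 1 := by simpa [Nat.lt_succ_iff] using hj
  have hc : r + (j + 1) * N = r + j * N + N := by ring
  obtain ⟨l, hl⟩ := Nat.exists_eq_add_of_le hj'
  rw [hc, Polynomial.coeff_X_pow_mul, ← sub_mul, ← mul_assoc,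
    show k + 1 + 1 - (j + 1) = l by omega, show k + 1 + 1 - j = l + 1 by omega,
    show k + 1 - j = l by omega, show r + k + 3 = (r + j + 1) + (l + 1) by omega, ← add_assoc r,
    Nat.factorial_succ, Nat.factorial_succ]
  push_cast
  ring

lemma exists_dicksonFunctional_pow_mul [CharP K p] {r k : ℕ} (hr : r + k + 2 < p) :
    ∃ μ : K, μ ≠ 0 ∧ ∀ q : Polynomial K, q.natDegree ≤ r + (p + 1) →
      dicksonFunctional K (p + 1) r k ((Polynomial.X ^ (p + 1) - 1) ^ k * q) =
        μ * (q.coeff r - (r + 1) * q.coeff (r + (p + 1))) := by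
  induction k with
  | zero =>
    refine ⟨r.factorial, ?_, fun q _ => ?_⟩
    · rw [Ne, CharP.cast_eq_zero_iff K p, (Fact.out : p.Prime).dvd_factorial]
      omega
    · simp [dicksonFunctional_apply, Finset.sum_range_succ, Nat.factorial_succ]
      ring
  | succ k ih =>
    obtain ⟨μ, hμ, h⟩ := ih (by omega)
    refine ⟨-((r + k + 3 : ℕ) : K) * μ,
      mul_ne_zero (neg_ne_zero.2 (natCast_ne_zero_of_lt_char (by omega) (by omega))) hμ,
      fun q hq => ?_⟩
    rw [pow_succ', mul_assoc, dicksonFunctional_mul (by omega), h q hq, mul_assoc]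
    convert natDegree_X_pow_sub_one_pow_mul_le hq using 1
    ring

end Functionals

section Existence

variable {p : ℕ} {K : Type*} [Field K]

lemma dicksonFunctional_derivation_relation [CharP K p] {r k : ℕ} (hr : r + k + 2 < p) {a : ℕ}
    (ha : a ≤ r + 2 + k * (p + 1)) :
    ((a : K) - (r + 2 + k * (p + 1) : ℕ)) *
        dicksonFunctional K (p + 1) r k (Polynomial.X ^ (p + a)) =
      a * dicksonFunctional K (p + 1) r k (Polynomial.X ^ (a - 1)) := by
  by_cases h : ∃ j ≤ k, a = r + j * (p + 1) + 1
  · obtain ⟨j, hj, rfl⟩ := h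
    obtain ⟨l, rfl⟩ := Nat.exists_eq_add_of_le hj
    rw [Nat.add_sub_cancel, show p + (r + j * (p + 1) + 1) = r + (j + 1) * (p + 1) by ring,
      dicksonFunctional_X_pow (by omega) (by omega), dicksonFunctional_X_pow (by omega) (by omega),
      show j + l + 1 - (j + 1) = l by omega, show j + l + 1 - j = l + 1 by omega, ← add_assoc r,
      Nat.factorial_succ, Nat.factorial_succ]
    push_cast
    rw [CharP.cast_eq_zero K p]
    ring
  · push Not at h
    rw [dicksonFunctional_X_pow_eq_zero (a := p + a), mul_zero, eq_comm]
    · rcases a with _ | a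
      · simp
      · rw [Nat.add_sub_cancel, dicksonFunctional_X_pow_eq_zero, mul_zero]
        intro j hj haj
        rcases hj.lt_or_eq with hj | rfl
        · exact h j (Nat.lt_succ_iff.1 hj) (by omega)
        · rw [add_mul] at haj
          omega
    · rintro (_ | j) hj haj
      · omega
      · exact h j (Nat.succ_le_succ_iff.1 hj) (by rw [add_mul] at haj; omega)

variable [Fact p.Prime]

lemma pow_torus_weight (hK : ∀ x : K, (x ^ p) ^ p = x) {r k a : ℕ} {x : K}
    (ha : dicksonFunctional K (p + 1) r k (Polynomial.X ^ a) ≠ 0) :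
    x ^ a * (x ^ p) ^ (r + (p + 1) + k * (p + 1) - a) * (x ^ p) ^ (p - 1) =
      x ^ (r + 2 + k * (p + 1)) := by
  have h : ∃ j ≤ k + 1, a = r + j * (p + 1) := by
    contrapose! ha
    exact dicksonFunctional_X_pow_eq_zero ha
  obtain ⟨j, hj, rfl⟩ := h
  obtain ⟨l, hl⟩ := Nat.exists_eq_add_of_le hj
  have hn : r + (p + 1) + k * (p + 1) - (r + j * (p + 1)) = (p + 1) * l := by
    have : (k + 1) * (p + 1) = (j + l) * (p + 1) := by rw [hl]
    rw [Nat.sub_eq_iff_eq_add (by nlinarith)]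
    linear_combination this
  have hp : (x ^ p) ^ (p - 1) * x ^ (p + 1) = x ^ 2 := by
    have h1 : (x ^ p) ^ (p - 1) * x ^ p = x := by
      rw [← pow_succ, Nat.sub_add_cancel (Fact.out : p.Prime).one_le, hK]
    rw [pow_succ, ← mul_assoc, h1, sq]
  have hN : (x ^ p) ^ ((p + 1) * l) = x ^ ((p + 1) * l) := by
    rw [pow_mul, pow_succ, hK, pow_mul, pow_succ, mul_comm]
  have hx : x ^ (r + j * (p + 1)) * x ^ ((p + 1) * l) = x ^ r * x ^ (k * (p + 1)) * x ^ (p + 1) := by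
    rw [← pow_add, ← pow_add, ← pow_add]
    congr 1
    linear_combination (p + 1) * hl.symm
  rw [hn, hN, hx, pow_add, pow_add]
  linear_combination x ^ r * x ^ (k * (p + 1)) * hp

variable [CharP K p]

lemma exists_eval_eq_dicksonFunctional [Algebra (ZMod p) K] {r k i : ℕ} (hr : r + k + 2 < p)
    (h₀ : 0 < i) (hi : i < p) (hK : ∀ x : K, (x ^ p) ^ p = x) {E : K →ₐ[ZMod p] K}
    (hE : ∀ x, E x = x ^ p) :
    ∃ F : Polynomial K, F.natDegree = p * i ∧ ∀ x,
      dicksonFunctional K (p + 1) r k ((Polynomial.X ^ (p + 1) - 1) ^ k *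
        (conjLin p x ^ i * (Polynomial.X - 1) ^ (r + (p + 1) - i))) = F.eval (E x) := by
  have hp := (Fact.out : p.Prime).one_lt
  obtain ⟨μ, hμ, h⟩ := exists_dicksonFunctional_pow_mul (K := K) hr
  have hmonic : (Polynomial.X - 1 : Polynomial K).Monic := Polynomial.monic_X_sub_C 1
  have hmonic' : (Polynomial.X ^ i * (Polynomial.X - 1) ^ (r + (p + 1) - i) :
      Polynomial K).Monic := (Polynomial.monic_X_pow i).mul (hmonic.pow _)
  have hdeg : (Polynomial.X ^ i * (Polynomial.X - 1) ^ (r + (p + 1) - i) :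
      Polynomial K).natDegree = r + (p + 1) := by
    rw [(Polynomial.monic_X_pow i).natDegree_mul (hmonic.pow _), Polynomial.natDegree_X_pow,
      hmonic.natDegree_pow, ← Polynomial.C_1, Polynomial.natDegree_X_sub_C]
    omega
  have key := exists_eval_eq_apply_conjLin (p := p)
    (dicksonFunctional K (p + 1) r k ∘ₗ LinearMap.mulLeft K ((Polynomial.X ^ (p + 1) - 1) ^ k))
    E (i := i) (j := r + (p + 1) - i) (s₀ := i) (fun s => p * s + (i - s)) (fun x s _ => ?_) le_rfl
    (fun s hs hne => ?_) (Nat.choose_self i) ?_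
  · simpa using key
  · rw [hE, pow_add, pow_mul (x ^ p), hK]
  · obtain ⟨t, rfl⟩ := Nat.exists_eq_add_of_le hs
    have : t < p * t := lt_mul_of_one_lt_left (by omega) hp
    simp only [Nat.add_sub_cancel_left, Nat.sub_self, mul_add]
    omega
  · rw [LinearMap.comp_apply, LinearMap.mulLeft_apply, h _ hdeg.le]
    have hlead := hmonic'.coeff_natDegree
    rw [hdeg] at hlead
    refine mul_ne_zero hμ ?_
    rw [hlead, Polynomial.coeff_X_pow_mul']
    split_ifs with hir
    · obtain ⟨s, rfl⟩ := Nat.exists_eq_add_of_le hir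
      rw [show i + s + (p + 1) - i = p + s + 1 by omega, Nat.add_sub_cancel_left,
        coeff_X_sub_one_pow_char_add (by omega)]
      have := natCast_ne_zero_of_lt_char (K := K) h₀ hi
      contrapose! this
      push_cast at this
      linear_combination -this
    · have := natCast_ne_zero_of_lt_char (K := K) (a := r + 1) (by omega) (by omega : r + 1 < p)
      contrapose! this
      push_cast
      linear_combination -this

lemma dicksonFunctional_X_sub_one_pow {r k : ℕ} (hr : r + k + 2 < p) :
    dicksonFunctional K (p + 1) r k ((Polynomial.X ^ (p + 1) - 1) ^ k *
      (Polynomial.X - 1) ^ (r + (p + 1))) = 0 := by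
  obtain ⟨μ, hμ, h⟩ := exists_dicksonFunctional_pow_mul (K := K) hr
  have hmonic : ((Polynomial.X - 1 : Polynomial K) ^ (r + (p + 1))).Monic :=
    (Polynomial.monic_X_sub_C 1).pow _
  have hdeg : ((Polynomial.X - 1 : Polynomial K) ^ (r + (p + 1))).natDegree = r + (p + 1) := by
    rw [← Polynomial.C_1, Polynomial.natDegree_pow, Polynomial.natDegree_X_sub_C, mul_one]
  have hlead := hmonic.coeff_natDegree
  rw [hdeg] at hlead
  rw [h _ hdeg.le, hlead, show r + (p + 1) = p + r + 1 by omega,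
    coeff_X_sub_one_pow_char_add (by omega)]
  ring

lemma exists_eval_eq_lcoeff [Algebra (ZMod p) K] {k i : ℕ} (h₀ : 0 < i) (hi : i < p) :
    ∃ F : Polynomial K, F.natDegree = p * i ∧ ∀ x,
      Polynomial.lcoeff K (1 + k * (p + 1)) ((Polynomial.X ^ (p + 1) - 1) ^ k *
        (conjLin p x ^ i * (Polynomial.X - 1) ^ (p - i))) = F.eval x := by
  have key := exists_eval_eq_apply_conjLin (p := p)
    (Polynomial.lcoeff K (1 + k * (p + 1)) ∘ₗ
      LinearMap.mulLeft K ((Polynomial.X ^ (p + 1) - 1) ^ k))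
    (AlgHom.id (ZMod p) K) (i := i) (j := p - i) (s₀ := 0) (fun s => s + p * (i - s))
    (fun x s _ => ?_) (Nat.zero_le i) (fun s hs hne => ?_) (Nat.choose_zero_right i) ?_
  · simpa using key
  · rw [pow_add, pow_mul, AlgHom.id_apply]
  · obtain ⟨t, rfl⟩ := Nat.exists_eq_add_of_le hs
    have : s < p * s := lt_mul_of_one_lt_left (by omega) (Fact.out : p.Prime).one_lt
    simp only [Nat.add_sub_cancel_left, Nat.sub_zero, mul_add]
    omega
  · have hdeg : ((Polynomial.X - 1 : Polynomial K) ^ (p - i)).natDegree < 1 + (p + 1) := by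
      rw [← Polynomial.C_1, Polynomial.natDegree_pow, Polynomial.natDegree_X_sub_C]
      omega
    rw [LinearMap.comp_apply, LinearMap.mulLeft_apply, pow_zero, one_mul, Polynomial.lcoeff_apply,
      coeff_X_pow_sub_one_pow_mul hdeg, sub_eq_add_neg, ← Polynomial.C_1, ← Polynomial.C_neg,
      Polynomial.coeff_X_add_C_pow, Nat.choose_one_right]
    exact mul_ne_zero (pow_ne_zero _ (neg_ne_zero.2 one_ne_zero))
      (natCast_ne_zero_of_lt_char (by omega) (by omega : p - i < p))

lemma lcoeff_X_sub_one_pow (k : ℕ) :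
    Polynomial.lcoeff K (1 + k * (p + 1)) ((Polynomial.X ^ (p + 1) - 1) ^ k *
      (Polynomial.X - 1) ^ p) = 0 := by
  have hp := (Fact.out : p.Prime).one_lt
  have hdeg : ((Polynomial.X - 1 : Polynomial K) ^ p).natDegree < 1 + (p + 1) := by
    rw [← Polynomial.C_1, Polynomial.natDegree_pow, Polynomial.natDegree_X_sub_C]
    omega
  rw [Polynomial.lcoeff_apply, coeff_X_pow_sub_one_pow_mul hdeg, sub_pow_char, one_pow,
    Polynomial.coeff_sub, Polynomial.coeff_X_pow, Polynomial.coeff_one, if_neg hp.ne,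
    if_neg one_ne_zero, sub_zero]

end Existence

/-- for odd `p`, `0 ≤ k ≤ p−2` and `−1 ≤ r ≤ p−3−k`, there is a
`G`-equivariant `𝔽_{p²}`-linear isomorphism
`((V_{r+(k+1)(p+1)} / D(V_{r+2+k(p+1)})) ⊗ V_{p−1}) ⊗ 𝔽_{p²} ≅ ind_T^G ω₂^{r+2+k(p+1)}`,
expressed here by a linear map `ψ` inducing it. -/
theorem cuspidal_twist_iso (p : ℕ) [Fact p.Prime] (hodd : Odd p)
    (k : ℕ) (hk : k ≤ p - 2) (r : ℤ) (hr1 : -1 ≤ r) (hr2 : r ≤ (p : ℤ) - 3 - k)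
    (K : Type*) [Field K] [Algebra (ZMod p) K] [Fintype K]
    (hK : Fintype.card K = p ^ 2)
    (α : K) (β : ZMod p) (hα : α ^ 2 = algebraMap (ZMod p) K β)
    (hα' : α ∉ Set.range (algebraMap (ZMod p) K)) :
    ∃ ψ : MvPolynomial (Fin 2 × Fin 2) K →ₗ[K]
        (Matrix.GeneralLinearGroup (Fin 2) (ZMod p) → K),
      -- `ψ_R` lies in `ind_T^G ω₂^{r+2+k(p+1)}`
      (∀ R : MvPolynomial (Fin 2 × Fin 2) K,
          IsBiHom (r + ((k : ℤ) + 1) * ((p : ℤ) + 1)).toNat (p - 1) R →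
        ∀ (t g : Matrix.GeneralLinearGroup (Fin 2) (ZMod p)) (u v : ZMod p),
          t.val = !![u, v * β; v, u] →
          ψ R (t * g) =
            (algebraMap (ZMod p) K u + algebraMap (ZMod p) K v * α) ^
                (r + 2 + (k : ℤ) * ((p : ℤ) + 1)).toNat * ψ R g) ∧
      -- `G`-equivariance
      (∀ (g : Matrix.GeneralLinearGroup (Fin 2) (ZMod p))
          (R : MvPolynomial (Fin 2 × Fin 2) K),
          IsBiHom (r + ((k : ℤ) + 1) * ((p : ℤ) + 1)).toNat (p - 1) R →
          ψ (actK p K g.val R) = fun x => ψ R (x * g)) ∧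
      -- the kernel on `V_{r+(k+1)(p+1)} ⊗ V_{p−1}` is `D(V_{r+2+k(p+1)}) ⊗ V_{p−1}`
      (∀ R : MvPolynomial (Fin 2 × Fin 2) K,
          IsBiHom (r + ((k : ℤ) + 1) * ((p : ℤ) + 1)).toNat (p - 1) R →
          (ψ R = 0 ↔ ∃ S, IsBiHom (r + 2 + (k : ℤ) * ((p : ℤ) + 1)).toNat (p - 1) S ∧
            DK p K S = R)) ∧
      -- surjectivity onto `ind_T^G ω₂^{r+2+k(p+1)}`
      (∀ h : Matrix.GeneralLinearGroup (Fin 2) (ZMod p) → K,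
          (∀ (t g : Matrix.GeneralLinearGroup (Fin 2) (ZMod p)) (u v : ZMod p),
              t.val = !![u, v * β; v, u] →
              h (t * g) =
                (algebraMap (ZMod p) K u + algebraMap (ZMod p) K v * α) ^
                    (r + 2 + (k : ℤ) * ((p : ℤ) + 1)).toNat * h g) →
          ∃ R, IsBiHom (r + ((k : ℤ) + 1) * ((p : ℤ) + 1)).toNat (p - 1) R ∧
            ψ R = h) := by
  have hp := (Fact.out : p.Prime).one_lt
  have : CharP K p := charP_of_injective_algebraMap (algebraMap (ZMod p) K).injective p
  have hKp : ∀ x : K, (x ^ p) ^ p = x := fun x => by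
    rw [← pow_mul, ← sq, ← hK, FiniteField.pow_card]
  obtain ⟨m, rfl⟩ : ∃ m : ℕ, r = m - 2 := ⟨(r + 2).toNat, by omega⟩
  have hm : 1 ≤ m := by omega
  have hmk : m + k ≤ p - 1 := by omega
  have hn₁ : ((m : ℤ) - 2 + ((k : ℤ) + 1) * ((p : ℤ) + 1)).toNat =
      m + (p - 1) + k * (p + 1) := by
    rw [show (m : ℤ) - 2 + ((k : ℤ) + 1) * ((p : ℤ) + 1) =
      (m + (p - 1) + k * (p + 1) : ℕ) by push_cast [hp.le]; ring, Int.toNat_natCast]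
  have hn₂ : ((m : ℤ) - 2 + 2 + (k : ℤ) * ((p : ℤ) + 1)).toNat = m + k * (p + 1) := by
    rw [show (m : ℤ) - 2 + 2 + (k : ℤ) * ((p : ℤ) + 1) = (m + k * (p + 1) : ℕ) by
      push_cast; ring, Int.toNat_natCast]
  rw [hn₁, hn₂]
  obtain rfl | hm' := hm.eq_or_lt
  · choose F hdeg hF using fun i : Fin (p - 1) =>
      exists_eval_eq_lcoeff (K := K) (k := k) i.1.succ_pos (by omega : i.1 + 1 < p)
    have hp' : 1 + (p - 1) = p := by omega
    refine exists_iso_of_functional hK hα hα' hm hmk (AlgHom.id _ _)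
      (Polynomial.lcoeff K (1 + k * (p + 1))) F (fun a ha x hx ha0 => ?_) (fun a ha => ?_) hdeg ?_ ?_
    · obtain rfl : a = 1 + k * (p + 1) := by
        by_contra h
        exact ha0 (by rw [Polynomial.lcoeff_apply, Polynomial.coeff_X_pow, if_neg (Ne.symm h)])
      have h1 : (x ^ p) ^ (p - 1) * x ^ (p - 1) = 1 := by
        refine mul_right_cancel₀ hx ?_
        rw [mul_assoc, ← pow_succ, Nat.sub_add_cancel hp.le, ← pow_succ, Nat.sub_add_cancel hp.le,
          hKp, one_mul]
      rw [show 1 + (p - 1) + k * (p + 1) - (1 + k * (p + 1)) = p - 1 by omega, AlgHom.id_apply,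
        mul_assoc, h1, mul_one]
    · simp only [Polynomial.lcoeff_apply, Polynomial.coeff_X_pow]
      rw [if_neg (by omega : ¬ 1 + k * (p + 1) = a - 1), mul_zero]
      split_ifs with h
      · rw [h]
        push_cast
        rw [CharP.cast_eq_zero K p]
        ring
      · rw [mul_zero]
    · rw [hp']
      exact hF
    · rw [hp']
      exact lcoeff_X_sub_one_pow k
  · obtain ⟨r, rfl⟩ := Nat.exists_eq_add_of_le' (Nat.succ_le_of_lt hm')
    have hr : r + k + 2 < p := by omega
    have hE : ∀ x : K, FiniteField.frobeniusAlgHom (ZMod p) K x = x ^ p := fun x => by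
      rw [FiniteField.frobeniusAlgHom_apply, ZMod.card]
    choose F hdeg hF using fun i : Fin (p - 1) =>
      exists_eval_eq_dicksonFunctional hr i.1.succ_pos (by omega : i.1 + 1 < p) hKp hE
    have hn : r + 2 + (p - 1) = r + (p + 1) := by omega
    refine exists_iso_of_functional hK hα hα' hm hmk (FiniteField.frobeniusAlgHom (ZMod p) K)
      (dicksonFunctional K (p + 1) r k) F (fun a _ x _ ha => ?_)
      (fun a ha => dicksonFunctional_derivation_relation hr ha) hdeg ?_ ?_
    · rw [hn, hE]
      exact pow_torus_weight hKp ha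
    · simpa only [hn] using hF
    · rw [hn]
      exact dicksonFunctional_X_sub_one_pow hr
end
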